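/- arXiv:1208.1052 — 5 statements merged into one kernel-verified Lean document; each statement's English description precedes it below -/
import Mathlib

section
/- For all j ≥ 1 and all n ≥ 1, the number a_{n,j}^{(j−1)} of 231-avoiding permutations σ of {1,…,n} with des(σ) = j and md(σ) ≤ j−1 satisfies n · a_{n,j}^{(j−1)} = C(n, j)·C(n, j+1) − n·C(n+j−1, 2j). -/
/-- σ avoids the pattern 231: no indices i < j < k with σ k < σ i < σ j. -/
def avoids231 {n : ℕ} (σ : Equiv.Perm (Fin n)) : Prop :=
  ¬ ∃ i j k : Fin n, i < j ∧ j < k ∧ σ k < σ i ∧ σ i < σ j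

/-- The number of descents of σ : positions i with σ i > σ (i+1). -/
noncomputable def des {n : ℕ} (σ : Equiv.Perm (Fin n)) : ℕ :=
  Nat.card {i : Fin n // ∃ h : (i : ℕ) + 1 < n, σ ⟨(i : ℕ) + 1, h⟩ < σ i}

/-- The maximum drop of σ : the maximum of i - σ i. -/
def maxDrop {n : ℕ} (σ : Equiv.Perm (Fin n)) : ℕ :=
  Finset.univ.sup fun i : Fin n => (i : ℕ) - (σ i : ℕ)

/-- a n j k : the number of 231-avoiding permutations of {1,…,n} with
j descents and maximum drop at most k. -/
noncomputable def a (n j k : ℕ) : ℕ :=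
  Nat.card {σ : Equiv.Perm (Fin n) // avoids231 σ ∧ des σ = j ∧ maxDrop σ ≤ k}

open Finset PowerSeries

namespace BinaryTree

/-- The number of descents of the 231-avoiding permutation coded by a binary tree. -/
def descents : BinaryTree Unit → ℕ
  | nil => 0
  | node _ l r => l.descents + if r = nil then 0 else r.descents + 1

/-- The maximum drop of the 231-avoiding permutation coded by a binary tree: the largest number
of right edges on a path starting at the root. -/
def rightHeight : BinaryTree Unit → ℕ
  | nil => 0
  | node _ l r => max l.rightHeight (if r = nil then 0 else r.rightHeight + 1)

theorem rightHeight_le_descents (t : BinaryTree Unit) : t.rightHeight ≤ t.descents := by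
  induction t with
  | nil => simp [rightHeight]
  | node _ l r hl hr =>
    simp only [rightHeight, descents]
    split_ifs <;> omega

theorem sum_treesOfNumNodesEq_succ {M : Type*} [AddCommMonoid M] (w : BinaryTree Unit → M)
    (n : ℕ) :
    ∑ t ∈ treesOfNumNodesEq (n + 1), w t =
      ∑ ij ∈ antidiagonal n,
        ∑ l ∈ treesOfNumNodesEq ij.1, ∑ r ∈ treesOfNumNodesEq ij.2, w (node () l r) := by
  rw [treesOfNumNodesEq_succ, sum_biUnion]
  · refine sum_congr rfl fun ij _ => ?_
    rw [pairwiseNode, sum_map, sum_product]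
    rfl
  · simp_rw [Set.PairwiseDisjoint, Set.Pairwise, Function.onFun, disjoint_left]
    rintro ⟨i, j⟩ _ ⟨i', j'⟩ _ hne t h1 h2
    simp only [mem_map, mem_product, mem_treesOfNumNodesEq] at h1 h2
    obtain ⟨⟨l, r⟩, ⟨hl, hr⟩, rfl⟩ := h1
    obtain ⟨⟨l', r'⟩, ⟨hl', hr'⟩, h⟩ := h2
    injection h with _ h h'
    grind

theorem ne_nil_of_mem {n : ℕ} {t : BinaryTree Unit} (h : t ∈ treesOfNumNodesEq (n + 1)) :
    t ≠ nil := by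
  rintro rfl
  simp [mem_treesOfNumNodesEq] at h

/-- The generating function of nonempty binary trees by nodes and descents. -/
noncomputable def descentSeries : PowerSeries (Polynomial ℤ) :=
  PowerSeries.mk fun n => if n = 0 then 0 else
    ∑ t ∈ treesOfNumNodesEq n, (Polynomial.X : Polynomial ℤ) ^ t.descents

theorem coeff_one_add_descentSeries (n : ℕ) :
    coeff n (1 + descentSeries) = ∑ t ∈ treesOfNumNodesEq n, Polynomial.X ^ t.descents := by
  rcases n with _ | n <;> simp [descentSeries, coeff_one, descents]

theorem coeff_one_add_X_mul_descentSeries (n : ℕ) :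
    coeff n (1 + C Polynomial.X * descentSeries) =
      ∑ t ∈ treesOfNumNodesEq n,
        (Polynomial.X : Polynomial ℤ) ^ (if t = nil then 0 else t.descents + 1) := by
  rcases n with _ | n
  · simp [descentSeries]
  · rw [map_add, coeff_C_mul, descentSeries, coeff_mk, coeff_one]
    simp only [Nat.add_eq_zero_iff, one_ne_zero, and_false, if_false, zero_add, mul_sum]
    refine sum_congr rfl fun t ht => ?_
    rw [if_neg (ne_nil_of_mem ht), pow_succ']

theorem descentSeries_eq :
    descentSeries = X * ((1 + descentSeries) * (1 + C Polynomial.X * descentSeries)) := by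
  ext1 n
  rcases n with _ | n
  · simp [descentSeries]
  · rw [coeff_succ_X_mul, coeff_mul]
    simp_rw [coeff_one_add_descentSeries, coeff_one_add_X_mul_descentSeries]
    rw [descentSeries, coeff_mk, if_neg n.succ_ne_zero, sum_treesOfNumNodesEq_succ]
    refine sum_congr rfl fun ij _ => ?_
    rw [sum_mul_sum]
    simp only [descents, pow_add]

/-- `k ↦ m.choose (k - 1)`, extended by zero at `k = 0`. -/
def choosePred (m : ℕ) : ℕ → ℤ
  | 0 => 0
  | k + 1 => m.choose k

theorem coeff_zero_descentSeries_pow_succ (r : ℕ) : coeff 0 (descentSeries ^ (r + 1)) = 0 := by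
  simp [descentSeries]

theorem coeff_succ_descentSeries_pow_succ (n r : ℕ) :
    coeff (n + 1) (descentSeries ^ (r + 1)) =
      coeff n (descentSeries ^ r) + coeff n (descentSeries ^ (r + 1)) +
        Polynomial.X * (coeff n (descentSeries ^ (r + 1)) + coeff n (descentSeries ^ (r + 2))) := by
  have h : descentSeries ^ (r + 1) =
      X * (descentSeries ^ r + descentSeries ^ (r + 1) +
        C Polynomial.X * (descentSeries ^ (r + 1) + descentSeries ^ (r + 2))) := by
    rw [pow_succ]
    nth_rw 2 [descentSeries_eq]
    ring
  conv_lhs => rw [h, coeff_succ_X_mul]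
  simp only [map_add, coeff_C_mul]

theorem coeff_coeff_descentSeries_pow (m r j : ℕ) :
    (coeff (m + 1) (descentSeries ^ (r + 1))).coeff j =
      m.choose j * m.choose (j + r) - choosePred m j * m.choose (j + r + 1) := by
  induction m generalizing r j with
  | zero =>
    rw [coeff_succ_descentSeries_pow_succ, coeff_zero_descentSeries_pow_succ,
      coeff_zero_descentSeries_pow_succ]
    rcases r with _ | r
    · rcases j with _ | j <;> simp [choosePred, Polynomial.coeff_one]
    · rw [coeff_zero_descentSeries_pow_succ]
      rcases j with _ | j <;> simp [choosePred]
  | succ m ih =>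
    rw [coeff_succ_descentSeries_pow_succ, Polynomial.coeff_add, Polynomial.coeff_add, ih]
    have h1 (j : ℕ) := ih 0 j
    simp only [zero_add, pow_one, add_zero] at h1
    rcases r with _ | r
    · rcases j with _ | _ | j <;>
      simp [h1, coeff_one, Polynomial.coeff_X_mul, ih, choosePred, Nat.choose_succ_succ'] <;> ring_nf
    · rcases j with _ | _ | j <;>
      simp [Polynomial.coeff_X_mul, ih, choosePred, Nat.choose_succ_succ', ← add_assoc] <;> ring_nf

theorem card_filter_descents (m j : ℕ) :
    (#{t ∈ treesOfNumNodesEq (m + 1) | t.descents = j} : ℤ) =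
      m.choose j * m.choose j - choosePred m j * m.choose (j + 1) := by
  have h := coeff_coeff_descentSeries_pow m 0 j
  rw [zero_add, pow_one, add_zero, descentSeries, coeff_mk, if_neg m.succ_ne_zero,
    Polynomial.finsetSum_coeff] at h
  rw [← h, card_filter]
  simp [Polynomial.coeff_X_pow, eq_comm]

theorem succ_mul_card_filter_descents (m j : ℕ) :
    ((m + 1 : ℕ) : ℤ) * #{t ∈ treesOfNumNodesEq (m + 1) | t.descents = j + 1} =
      (m + 1).choose (j + 1) * (m + 1).choose (j + 2) := by
  rw [card_filter_descents]
  have h1 : ((m + 1).choose (j + 1) : ℤ) * (j + 1) = (m + 1) * m.choose j := by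
    exact_mod_cast (Nat.add_one_mul_choose_eq m j).symm
  have h2 : ((m + 1).choose (j + 2) : ℤ) * (j + 2) = (m + 1) * m.choose (j + 1) := by
    exact_mod_cast (Nat.add_one_mul_choose_eq m (j + 1)).symm
  rw [Nat.choose_succ_succ' m j] at h1
  rw [Nat.choose_succ_succ' m (j + 1)] at h2
  rw [Nat.choose_succ_succ' m j, Nat.choose_succ_succ' m (j + 1)]
  push_cast [choosePred] at h1 h2 ⊢
  linear_combination (m.choose (j + 1) + m.choose (j + 2) : ℤ) * h1 -
    (m.choose j + m.choose (j + 1) : ℤ) * h2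

theorem card_filter_descents_eq_zero (n : ℕ) :
    #{t ∈ treesOfNumNodesEq n | t.descents = 0} = 1 := by
  induction n with
  | zero =>
    rw [treesOfNumNodesEq_zero]
    rfl
  | succ n ih =>
    rw [card_filter] at ih ⊢
    rw [sum_treesOfNumNodesEq_succ, Finset.Nat.sum_antidiagonal_eq_sum_range_succ_mk,
      sum_range_succ, Nat.sub_self, treesOfNumNodesEq_zero, sum_eq_zero, zero_add]
    · simpa only [sum_singleton, descents, if_true, add_zero] using ih
    · intro i hi
      obtain ⟨k, hk⟩ := Nat.exists_eq_add_of_lt (mem_range.mp hi)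
      refine sum_eq_zero fun l _ => sum_eq_zero fun r hr => if_neg ?_
      rw [hk, show i + k + 1 - i = k + 1 by omega] at hr
      simp [descents, ne_nil_of_mem hr]

theorem card_filter_rightHeight_eq_descents_succ (n j : ℕ) :
    #{t ∈ treesOfNumNodesEq (n + 1) | t.descents = j + 1 ∧ t.rightHeight = j + 1} =
      #{t ∈ treesOfNumNodesEq n | t.descents = j + 1 ∧ t.rightHeight = j + 1} +
        ∑ i ∈ range n, #{t ∈ treesOfNumNodesEq (i + 1) | t.descents = j ∧ t.rightHeight = j} := by
  rw [card_filter, sum_treesOfNumNodesEq_succ, ← Finset.Nat.sum_antidiagonal_swap,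
    Finset.Nat.sum_antidiagonal_eq_sum_range_succ_mk, sum_range_succ', add_comm]
  congr 1
  · rw [card_filter]
    simp only [Prod.swap, Nat.sub_zero, treesOfNumNodesEq_zero, sum_singleton, descents,
      rightHeight, if_true, add_zero, _root_.max_zero]
  · refine sum_congr rfl fun i _ => ?_
    have h := card_filter_descents_eq_zero (n - (i + 1))
    rw [card_filter] at h
    refine Eq.trans ?_ ((congrArg (· * _) h).trans (one_mul _))
    simp only [Prod.swap, card_filter, sum_mul_sum]
    refine sum_congr rfl fun l _ => sum_congr rfl fun r hr => ?_
    have := l.rightHeight_le_descents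
    have := r.rightHeight_le_descents
    simp only [descents, rightHeight, if_neg (ne_nil_of_mem hr), ite_mul, one_mul, zero_mul,
      ← ite_and]
    refine if_congr ?_ rfl rfl
    omega

theorem sum_range_choose_add (n j : ℕ) :
    ∑ i ∈ range n, (i + j).choose (2 * j) = (n + j).choose (2 * j + 1) := by
  induction n with
  | zero => rw [range_zero, sum_empty, Nat.choose_eq_zero_of_lt (by omega)]
  | succ n ih => rw [sum_range_succ, ih, add_right_comm, Nat.choose_succ_succ', add_comm]

theorem card_filter_rightHeight_eq_descents (n j : ℕ) :
    #{t ∈ treesOfNumNodesEq (n + 1) | t.descents = j ∧ t.rightHeight = j} =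
      (n + j).choose (2 * j) := by
  induction j generalizing n with
  | zero =>
    rw [mul_zero, Nat.choose_zero_right]
    refine (congrArg card (filter_congr fun t _ => ?_)).trans (card_filter_descents_eq_zero (n + 1))
    have := t.rightHeight_le_descents
    omega
  | succ j ihj =>
    induction n with
    | zero =>
      rw [card_filter_rightHeight_eq_descents_succ, Nat.choose_eq_zero_of_lt (by omega)]
      simp [descents]
    | succ n ihn =>
      rw [card_filter_rightHeight_eq_descents_succ, ihn, sum_congr rfl fun i _ => ihj i,
        sum_range_choose_add, add_comm, add_right_comm n 1 j,
        show n + 1 + (j + 1) = n + j + 1 + 1 by ring,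
        show 2 * (j + 1) = 2 * j + 1 + 1 by ring, Nat.choose_succ_succ' (n + j + 1), add_assoc n j 1]

theorem card_filter_descents_eq_add (n j : ℕ) :
    #{t ∈ treesOfNumNodesEq n | t.descents = j + 1} =
      #{t ∈ treesOfNumNodesEq n | t.descents = j + 1 ∧ t.rightHeight ≤ j} +
        #{t ∈ treesOfNumNodesEq n | t.descents = j + 1 ∧ t.rightHeight = j + 1} := by
  rw [← card_union_of_disjoint (disjoint_filter.mpr fun t _ => by omega), ← filter_or]
  refine congrArg card (filter_congr fun t _ => ?_)
  have := t.rightHeight_le_descents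
  omega

end BinaryTree
/-- `f` restricts to a 231-avoiding permutation of `{0, …, n - 1}` and fixes all other numbers. -/
structure IsAvoider (n : ℕ) (f : ℕ → ℕ) : Prop where
  lt : ∀ x < n, f x < n
  inj : ∀ x < n, ∀ y < n, f x = f y → x = y
  fixed : ∀ x, n ≤ x → f x = x
  avoids : ∀ x y z, x < y → y < z → z < n → f z < f x → ¬ f x < f y

/-- The word `f`, followed by the new maximum `i + m`, followed by the word `g` shifted up
by `i`. -/
def glue (i m : ℕ) (f g : ℕ → ℕ) (x : ℕ) : ℕ :=
  if x < i then f x else if x = i then i + m else if x ≤ i + m then g (x - i - 1) + i else x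

section glue

variable {i m : ℕ} {f g : ℕ → ℕ}

theorem glue_of_lt {x : ℕ} (h : x < i) : glue i m f g x = f x := if_pos h

theorem glue_self : glue i m f g i = i + m := by simp [glue]

theorem glue_add {y : ℕ} (h : y < m) : glue i m f g (i + 1 + y) = g y + i := by
  rw [glue, if_neg (by omega), if_neg (by omega), if_pos (by omega)]
  congr 2
  omega

theorem glue_of_gt {x : ℕ} (h : i + m < x) : glue i m f g x = x := by
  rw [glue, if_neg (by omega), if_neg (by omega), if_neg (by omega)]

theorem position_cases {x : ℕ} (h : x < i + m + 1) : x < i ∨ x = i ∨ ∃ y < m, x = i + 1 + y := by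
  rcases lt_trichotomy x i with h | h | h
  · exact .inl h
  · exact .inr (.inl h)
  · exact .inr (.inr ⟨x - i - 1, by omega, by omega⟩)

theorem glue_cases (hf : IsAvoider i f) (hg : IsAvoider m g) {x : ℕ} (h : x < i + m + 1) :
    (x < i ∧ glue i m f g x = f x ∧ f x < i) ∨ (x = i ∧ glue i m f g x = i + m) ∨
      ∃ y < m, x = i + 1 + y ∧ glue i m f g x = g y + i ∧ g y < m := by
  rcases position_cases h with h' | rfl | ⟨y, h', rfl⟩
  · exact .inl ⟨h', glue_of_lt h', hf.lt x h'⟩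
  · exact .inr (.inl ⟨rfl, glue_self⟩)
  · exact .inr (.inr ⟨y, h', rfl, glue_add h', hg.lt y h'⟩)

theorem IsAvoider.glue (hf : IsAvoider i f) (hg : IsAvoider m g) :
    IsAvoider (i + m + 1) (glue i m f g) where
  lt x hx := by
    rcases glue_cases hf hg hx with h | h | ⟨x', h⟩ <;> omega
  inj x hx y hy e := by
    rcases glue_cases hf hg hx with h | h | ⟨x', h⟩ <;>
    rcases glue_cases hf hg hy with h' | h' | ⟨y', h'⟩ <;>
    try omega
    · have := hf.inj x h.1 y h'.1
      omega
    · have := hg.inj x' h.1 y' h'.1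
      omega
  fixed x hx := glue_of_gt hx
  avoids x y z hxy hyz hz := by
    have hy := hyz.trans hz
    have hx := hxy.trans hy
    rcases glue_cases hf hg hx with h | h | ⟨x', h⟩ <;>
    rcases glue_cases hf hg hy with h' | h' | ⟨y', h'⟩ <;>
    rcases glue_cases hf hg hz with h'' | h'' | ⟨z', h''⟩ <;>
    try omega
    · have := hf.avoids x y z hxy hyz h''.1
      omega
    · have := hg.avoids x' y' z' (by omega) (by omega) h''.1
      omega

theorem glue_inj {i' m' : ℕ} {f' g' : ℕ → ℕ} (hf : IsAvoider i f) (hg : IsAvoider m g)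
    (hf' : IsAvoider i' f') (hg' : IsAvoider m' g') (hn : i + m = i' + m')
    (h : glue i m f g = glue i' m' f' g') : i = i' ∧ m = m' ∧ f = f' ∧ g = g' := by
  obtain rfl : i = i' := by
    refine (hf.glue hg).inj i (by omega) i' (by omega) ?_
    rw [glue_self, h, glue_self, hn]
  obtain rfl : m = m' := by omega
  refine ⟨rfl, rfl, ?_, ?_⟩
  · ext x
    rcases lt_or_ge x i with hx | hx
    · rw [← glue_of_lt (m := m) (f := f) (g := g) hx, h, glue_of_lt hx]
    · rw [hf.fixed x hx, hf'.fixed x hx]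
  · ext x
    rcases lt_or_ge x m with hx | hx
    · apply Nat.add_right_cancel (m := i)
      rw [← glue_add (i := i) (f := f) hx, h, glue_add hx]
    · rw [hg.fixed x hx, hg'.fixed x hx]

theorem IsAvoider.exists_glue {n : ℕ} {h : ℕ → ℕ} (hh : IsAvoider (n + 1) h) :
    ∃ i m f g, i + m = n ∧ IsAvoider i f ∧ IsAvoider m g ∧ h = _root_.glue i m f g := by
  obtain ⟨i, hi, hin⟩ : ∃ i < n + 1, h i = n := by
    have hs := Finset.surj_on_of_inj_on_of_card_le (s := range (n + 1)) (t := range (n + 1))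
      (fun x _ => h x) (fun x hx => mem_range.mpr (hh.lt x (mem_range.mp hx)))
      (fun x y hx hy => hh.inj x (mem_range.mp hx) y (mem_range.mp hy)) le_rfl n (by simp)
    obtain ⟨i, hi, hin⟩ := hs
    exact ⟨i, mem_range.mp hi, hin.symm⟩
  obtain ⟨m, rfl⟩ := Nat.exists_eq_add_of_le (Nat.lt_succ_iff.mp hi)
  have hlt (x : ℕ) (hx : x < i + m + 1) (hxi : x ≠ i) : h x < i + m := by
    have := hh.lt x hx
    have := mt (hh.inj x hx i hi) hxi
    omega
  have hlr (x y : ℕ) (hx : x < i) (hy : i < y) (hy' : y < i + m + 1) : h x < h y := by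
    have := hh.avoids x i y hx hy hy'
    have := hlt x (by omega) (by omega)
    have := mt (hh.inj x (by omega) y hy') (by omega)
    omega
  have hl (x : ℕ) (hx : x < i) : h x < i := by
    by_contra hc
    have := card_le_card_of_injOn (s := Ico (i + 1) (i + m + 1)) (t := Ico (h x + 1) (i + m)) h
      (fun y hy => by
        simp only [coe_Ico, Set.mem_Ico] at hy ⊢
        exact ⟨hlr x y hx hy.1 hy.2, hlt y hy.2 (by omega)⟩)
      (fun y hy z hz => by
        simp only [coe_Ico, Set.mem_Ico] at hy hz
        exact hh.inj y hy.2 z hz.2)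
    simp only [Nat.card_Ico] at this
    have := hlt x (by omega) (by omega)
    omega
  have hr (y : ℕ) (hy : i < y) (hy' : y < i + m + 1) : i ≤ h y := by
    by_contra hc
    have := card_le_card_of_injOn (s := range i) (t := range (h y)) h
      (fun x hx => by
        simp only [coe_range, Set.mem_Iio] at hx ⊢
        exact hlr x y hx hy hy')
      (fun x hx z hz => by
        simp only [coe_range, Set.mem_Iio] at hx hz
        exact hh.inj x (by omega) z (by omega))
    simp only [card_range] at this
    omega
  refine ⟨i, m, fun x => if x < i then h x else x,
    fun y => if y < m then h (i + 1 + y) - i else y, rfl, ?_, ?_, ?_⟩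
  · constructor
    · intro x hx
      simpa only [if_pos hx] using hl x hx
    · intro x hx y hy e
      simp only [if_pos hx, if_pos hy] at e
      exact hh.inj x (by omega) y (by omega) e
    · intro x hx
      exact if_neg hx.not_gt
    · intro x y z hxy hyz hz
      simp only [if_pos hz, if_pos (hyz.trans hz), if_pos (hxy.trans (hyz.trans hz))]
      exact hh.avoids x y z hxy hyz (by omega)
  · constructor
    · intro x hx
      have := hlt (i + 1 + x) (by omega) (by omega)
      simp only [if_pos hx]
      omega
    · intro x hx y hy e
      have := hr (i + 1 + x) (by omega) (by omega)
      have := hr (i + 1 + y) (by omega) (by omega)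
      have := hh.inj (i + 1 + x) (by omega) (i + 1 + y) (by omega)
      simp only [if_pos hx, if_pos hy] at e
      omega
    · intro x hx
      exact if_neg hx.not_gt
    · intro x y z hxy hyz hz
      have := hr (i + 1 + x) (by omega) (by omega)
      have := hr (i + 1 + y) (by omega) (by omega)
      have := hr (i + 1 + z) (by omega) (by omega)
      have := hh.avoids (i + 1 + x) (i + 1 + y) (i + 1 + z) (by omega) (by omega) (by omega)
      simp only [if_pos hz, if_pos (hyz.trans hz), if_pos (hxy.trans (hyz.trans hz))]
      omega
  · ext x
    rcases lt_or_ge x (i + m + 1) with hx | hx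
    · rcases position_cases hx with hx' | rfl | ⟨y, hy, rfl⟩
      · rw [glue_of_lt hx', if_pos hx']
      · rw [glue_self, hin]
      · rw [glue_add hy, if_pos hy, Nat.sub_add_cancel (hr _ (by omega) hx)]
    · rw [glue_of_gt hx, hh.fixed x hx]

/-- The number of descents among the first `n` values of `f`. -/
def natDes (n : ℕ) (f : ℕ → ℕ) : ℕ :=
  #{x ∈ range (n - 1) | f (x + 1) < f x}

theorem natDes_glue (hf : IsAvoider i f) (hg : IsAvoider m g) :
    natDes (i + m + 1) (glue i m f g) = natDes i f + if m = 0 then 0 else natDes m g + 1 := by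
  simp only [natDes, card_filter, Nat.add_sub_cancel]
  rw [sum_range_add]
  congr 1
  · rcases i with _ | i
    · simp
    · rw [sum_range_succ, glue_self, glue_of_lt (Nat.lt_succ_self i), if_neg, add_zero,
        Nat.add_sub_cancel]
      · refine sum_congr rfl fun x hx => ?_
        rw [mem_range] at hx
        rw [glue_of_lt (by omega), glue_of_lt (by omega)]
      · have := hf.lt i (by omega)
        omega
  · rcases m with _ | m
    · simp
    · rw [sum_range_succ', if_neg m.succ_ne_zero, Nat.add_sub_cancel, add_zero, glue_self]
      congr 1
      · refine sum_congr rfl fun x hx => ?_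
        rw [mem_range] at hx
        rw [show i + (x + 1) + 1 = i + 1 + (x + 1) by ring, glue_add (by omega),
          show i + (x + 1) = i + 1 + x by ring, glue_add (by omega)]
        simp
      · have := hg.lt 0 (by omega)
        rw [← add_zero (i + 1), glue_add (by omega), if_pos (by omega)]

theorem forall_le_glue_add_iff (k : ℕ) :
    (∀ x < i + m + 1, x ≤ glue i m f g x + k) ↔
      (∀ x < i, x ≤ f x + k) ∧ ∀ y < m, y + 1 ≤ g y + k := by
  refine ⟨fun h => ⟨fun x hx => ?_, fun y hy => ?_⟩, fun h x hx => ?_⟩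
  · simpa only [glue_of_lt hx] using h x (by omega)
  · have := h (i + 1 + y) (by omega)
    rw [glue_add hy] at this
    omega
  · rcases position_cases hx with h' | rfl | ⟨y, h', rfl⟩
    · rw [glue_of_lt h']
      exact h.1 x h'
    · rw [glue_self]
      omega
    · rw [glue_add h']
      have := h.2 y h'
      omega

end glue

namespace BinaryTree

/-- The 231-avoiding permutation coded by a binary tree, as a function on `ℕ`. -/
def toFun : BinaryTree Unit → ℕ → ℕ
  | nil => id
  | node _ l r => glue l.numNodes r.numNodes l.toFun r.toFun

theorem isAvoider_toFun (t : BinaryTree Unit) : IsAvoider t.numNodes t.toFun := by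
  induction t with
  | nil => constructor <;> simp [toFun]
  | node _ l r hl hr => exact hl.glue hr

theorem numNodes_eq_zero {t : BinaryTree Unit} : t.numNodes = 0 ↔ t = nil := by
  cases t <;> simp

theorem toFun_injective {s t : BinaryTree Unit} (hn : s.numNodes = t.numNodes)
    (h : s.toFun = t.toFun) : s = t := by
  induction s generalizing t with
  | nil => exact (numNodes_eq_zero.mp hn.symm).symm
  | node _ l r hl hr =>
    cases t with
    | nil => simp at hn
    | node _ l' r' =>
      obtain ⟨h1, h2, h3, h4⟩ := glue_inj l.isAvoider_toFun r.isAvoider_toFun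
        l'.isAvoider_toFun r'.isAvoider_toFun (Nat.succ_injective hn) h
      rw [hl h1 h3, hr h2 h4]

theorem exists_toFun_eq {n : ℕ} {f : ℕ → ℕ} (hf : IsAvoider n f) :
    ∃ t : BinaryTree Unit, t.numNodes = n ∧ t.toFun = f := by
  induction n using Nat.strong_induction_on generalizing f with
  | _ n ih =>
    rcases n with _ | n
    · exact ⟨nil, rfl, funext fun x => (hf.fixed x x.zero_le).symm⟩
    · obtain ⟨i, m, f, g, rfl, hl, hr, rfl⟩ := hf.exists_glue
      obtain ⟨l, rfl, rfl⟩ := ih i (by omega) hl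
      obtain ⟨r, rfl, rfl⟩ := ih m (by omega) hr
      exact ⟨node () l r, rfl, rfl⟩

theorem natDes_toFun (t : BinaryTree Unit) : natDes t.numNodes t.toFun = t.descents := by
  induction t with
  | nil => rfl
  | node _ l r hl hr =>
    simp only [numNodes, toFun, descents,
      natDes_glue l.isAvoider_toFun r.isAvoider_toFun, hl, hr, numNodes_eq_zero]

theorem rightHeight_le_iff (t : BinaryTree Unit) (k : ℕ) :
    t.rightHeight ≤ k ↔ ∀ x < t.numNodes, x ≤ t.toFun x + k := by
  induction t generalizing k with
  | nil => simp [rightHeight]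
  | node _ l r hl hr =>
    rw [rightHeight, numNodes, toFun, forall_le_glue_add_iff, ← hl, max_le_iff, and_congr_right_iff]
    intro _
    split_ifs with h
    · simp [h]
    · rcases k with _ | k
      · have hpos := Nat.pos_of_ne_zero (mt numNodes_eq_zero.mp h)
        refine iff_of_false (by omega) fun hc => ?_
        have := hc (r.numNodes - 1) (by omega)
        have := r.isAvoider_toFun.lt (r.numNodes - 1) (by omega)
        omega
      · rw [Nat.succ_le_succ_iff, hr]
        simp only [← add_assoc, Nat.add_le_add_iff_right]

end BinaryTree

section extension

variable {n : ℕ}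

/-- The extension of a permutation of `Fin n` to `ℕ` by the identity. -/
def extendNat (σ : Equiv.Perm (Fin n)) (x : ℕ) : ℕ :=
  if h : x < n then σ ⟨x, h⟩ else x

theorem extendNat_of_lt (σ : Equiv.Perm (Fin n)) {x : ℕ} (h : x < n) :
    extendNat σ x = σ ⟨x, h⟩ := dif_pos h

theorem extendNat_injective : Function.Injective (extendNat (n := n)) := by
  intro σ τ h
  ext x
  simpa only [extendNat_of_lt _ x.isLt] using congrFun h x

theorem isAvoider_extendNat_iff (σ : Equiv.Perm (Fin n)) :
    IsAvoider n (extendNat σ) ↔ avoids231 σ := by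
  constructor
  · rintro h ⟨x, y, z, hxy, hyz, h1, h2⟩
    have := h.avoids x y z hxy hyz z.isLt
    simp only [extendNat_of_lt _ (Fin.isLt _)] at this
    exact this h1 h2
  · intro h
    constructor
    · intro x hx
      rw [extendNat_of_lt σ hx]
      exact (σ ⟨x, hx⟩).isLt
    · intro x hx y hy e
      rw [extendNat_of_lt σ hx, extendNat_of_lt σ hy] at e
      exact Fin.mk.inj (σ.injective (Fin.ext e))
    · intro x hx
      exact dif_neg hx.not_gt
    · intro x y z hxy hyz hz h1 h2
      have hy := hyz.trans hz
      rw [extendNat_of_lt σ (hxy.trans hy)] at h1 h2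
      rw [extendNat_of_lt σ hz] at h1
      rw [extendNat_of_lt σ hy] at h2
      exact h ⟨_, _, _, hxy, hyz, h1, h2⟩

theorem IsAvoider.exists_extendNat {f : ℕ → ℕ} (hf : IsAvoider n f) :
    ∃ σ : Equiv.Perm (Fin n), extendNat σ = f := by
  have hinj : Function.Injective fun x : Fin n => (⟨f x, hf.lt x x.isLt⟩ : Fin n) :=
    fun x y e => Fin.ext (hf.inj x x.isLt y y.isLt (Fin.mk.inj e))
  refine ⟨Equiv.ofBijective _ (Finite.injective_iff_bijective.mp hinj), ?_⟩
  ext x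
  rcases lt_or_ge x n with hx | hx
  · rw [extendNat_of_lt _ hx]
    rfl
  · rw [hf.fixed x hx]
    exact dif_neg hx.not_gt

theorem natDes_extendNat (σ : Equiv.Perm (Fin n)) : natDes n (extendNat σ) = des σ := by
  have key (x : ℕ) (hx : x < n) : (∃ h : x + 1 < n, σ ⟨x + 1, h⟩ < σ ⟨x, hx⟩) ↔
      x ∈ (range (n - 1)).filter fun x => extendNat σ (x + 1) < extendNat σ x := by
    rw [mem_filter, mem_range, ← exists_prop]
    constructor
    · rintro ⟨h, hlt⟩
      exact ⟨by omega, by rwa [extendNat_of_lt σ h, extendNat_of_lt σ hx]⟩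
    · rintro ⟨h, hlt⟩
      have h' : x + 1 < n := by omega
      rw [extendNat_of_lt σ h', extendNat_of_lt σ hx] at hlt
      exact ⟨h', hlt⟩
  have lt_of_mem {x : ℕ}
      (h : x ∈ (range (n - 1)).filter fun x => extendNat σ (x + 1) < extendNat σ x) : x < n := by
    rw [mem_filter, mem_range] at h
    omega
  rw [des, natDes, ← Nat.card_eq_finsetCard]
  exact Nat.card_congr
    { toFun x := ⟨⟨x, lt_of_mem x.2⟩, (key x (lt_of_mem x.2)).mpr x.2⟩
      invFun i := ⟨i.1, (key i.1 i.1.isLt).mp i.2⟩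
      left_inv _ := rfl
      right_inv _ := rfl }

theorem maxDrop_le_iff (σ : Equiv.Perm (Fin n)) (k : ℕ) :
    maxDrop σ ≤ k ↔ ∀ x < n, x ≤ extendNat σ x + k := by
  simp only [maxDrop, Finset.sup_le_iff, mem_univ, true_imp_iff, Fin.forall_iff]
  refine forall₂_congr fun x hx => ?_
  rw [extendNat_of_lt σ hx, tsub_le_iff_left]

end extension

theorem a_eq_card_filter (n j k : ℕ) :
    a n j k = #{t ∈ BinaryTree.treesOfNumNodesEq n | t.descents = j ∧ t.rightHeight ≤ k} := by
  have h : extendNat '' {σ : Equiv.Perm (Fin n) | avoids231 σ ∧ des σ = j ∧ maxDrop σ ≤ k} =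
      BinaryTree.toFun '' {t ∈ BinaryTree.treesOfNumNodesEq n |
        t.descents = j ∧ t.rightHeight ≤ k} := by
    ext f
    constructor
    · rintro ⟨σ, ⟨h1, h2, h3⟩, rfl⟩
      obtain ⟨t, rfl, ht⟩ := BinaryTree.exists_toFun_eq ((isAvoider_extendNat_iff σ).mpr h1)
      refine ⟨t, ⟨BinaryTree.mem_treesOfNumNodesEq.mpr rfl, ?_, ?_⟩, ht⟩
      · rw [← t.natDes_toFun, ht, natDes_extendNat, h2]
      · rwa [t.rightHeight_le_iff, ht, ← maxDrop_le_iff]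
    · rintro ⟨t, ⟨h1, h2, h3⟩, rfl⟩
      obtain rfl := BinaryTree.mem_treesOfNumNodesEq.mp h1
      obtain ⟨σ, hσ⟩ := t.isAvoider_toFun.exists_extendNat
      refine ⟨σ, ⟨?_, ?_, ?_⟩, hσ⟩
      · rw [← isAvoider_extendNat_iff, hσ]
        exact t.isAvoider_toFun
      · rw [← natDes_extendNat, hσ, t.natDes_toFun, h2]
      · rwa [maxDrop_le_iff, hσ, ← t.rightHeight_le_iff]
  have hinj : Set.InjOn BinaryTree.toFun {t ∈ BinaryTree.treesOfNumNodesEq n |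
      t.descents = j ∧ t.rightHeight ≤ k} := by
    rintro s ⟨hs, _⟩ t ⟨ht, _⟩
    rw [BinaryTree.mem_treesOfNumNodesEq] at hs ht
    exact BinaryTree.toFun_injective (hs.trans ht.symm)
  rw [← Set.ncard_coe_finset, coe_filter, ← hinj.ncard_image, ← h,
    Set.ncard_image_of_injective _ extendNat_injective]
  rfl

theorem a_j_minus_one (n j : ℕ) (hj : 1 ≤ j) (hn : 1 ≤ n) :
    (n : ℤ) * a n j (j - 1) =
      (n.choose j : ℤ) * n.choose (j + 1) - (n : ℤ) * (n + j - 1).choose (2 * j) := by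
  obtain ⟨n, rfl⟩ := Nat.exists_eq_add_of_le' hn
  obtain ⟨j, rfl⟩ := Nat.exists_eq_add_of_le' hj
  have h := BinaryTree.card_filter_descents_eq_add (n + 1) j
  rw [BinaryTree.card_filter_rightHeight_eq_descents] at h
  rw [a_eq_card_filter, ← BinaryTree.succ_mul_card_filter_descents, h, Nat.add_sub_cancel,
    show n + 1 + (j + 1) - 1 = n + (j + 1) by omega]
  push_cast
  ring
end

section
/- For all j ≥ 2 and all n ≥ 1, the number of 231-avoiding permutations σ of {1,…,n} with des(σ) = j and md(σ) = j−1 (maximum drop exactly j−1) equals (2j−3)·C(n+j−2, 2j). -/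
open Finset BinaryTree

/-- The number of right edges of a binary tree. -/
def rightEdges : BinaryTree Unit → ℕ
  | .nil => 0
  | .node _ l r => rightEdges l + rightEdges r + if r = .nil then 0 else 1

/-- The maximal number of right edges on a path descending from the root. -/
def rightDepth : BinaryTree Unit → ℕ
  | .nil => 0
  | .node _ l r => max (rightDepth l) (rightDepth r + if r = .nil then 0 else 1)

theorem rightDepth_le_rightEdges (t : BinaryTree Unit) : rightDepth t ≤ rightEdges t := by
  induction t with
  | nil => simp [rightDepth, rightEdges]
  | node _ l r hl hr => simp only [rightDepth, rightEdges]; omega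

theorem rightEdges_eq_zero_of_rightDepth (t : BinaryTree Unit) (h : rightDepth t = 0) :
    rightEdges t = 0 := by
  induction t with
  | nil => simp [rightEdges]
  | node _ l r hl hr =>
    simp only [rightDepth, rightEdges] at h ⊢
    have := hl (by omega)
    have := hr (by omega)
    omega

/-- The number of binary trees with `n` nodes, `j` right edges and right depth `k`. -/
def treeCount (j k n : ℕ) : ℕ :=
  #{t ∈ treesOfNumNodesEq n | rightEdges t = j ∧ rightDepth t = k}

/-- The number of nonempty binary trees with `n` nodes, `j` right edges and right depth `k`. -/
def treeCountPos (j k n : ℕ) : ℕ := if n = 0 then 0 else treeCount j k n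

theorem treeCount_eq_sum (j k n : ℕ) : treeCount j k n =
    ∑ t ∈ treesOfNumNodesEq n, if rightEdges t = j ∧ rightDepth t = k then 1 else 0 := by
  rw [treeCount, card_filter]

theorem treeCountPos_eq_sum (j k n : ℕ) : treeCountPos j k n =
    ∑ t ∈ treesOfNumNodesEq n,
      if t ≠ .nil ∧ rightEdges t = j ∧ rightDepth t = k then 1 else 0 := by
  rcases n with _ | n
  · rw [treeCountPos, if_pos rfl, treesOfNumNodesEq_zero, sum_singleton]
    simp
  · rw [treeCountPos, if_neg (by omega), treeCount_eq_sum]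
    refine sum_congr rfl fun t ht => ?_
    have : t ≠ .nil := by
      rintro rfl
      simp [mem_treesOfNumNodesEq] at ht
    simp [this]

theorem sum_treesOfNumNodesEq_succ (f : BinaryTree Unit → ℕ) (n : ℕ) :
    ∑ t ∈ treesOfNumNodesEq (n + 1), f t = ∑ p ∈ antidiagonal n,
      ∑ l ∈ treesOfNumNodesEq p.1, ∑ r ∈ treesOfNumNodesEq p.2, f (.node () l r) := by
  rw [treesOfNumNodesEq_succ, sum_biUnion]
  · refine sum_congr rfl fun p _ => ?_
    rw [pairwiseNode, sum_map, sum_product]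
    rfl
  · simp_rw [Set.PairwiseDisjoint, Set.Pairwise, Function.onFun, disjoint_left]
    rintro ⟨i, j⟩ _ ⟨i', j'⟩ _ h a ha hb
    simp only [pairwiseNode, mem_map, mem_product, mem_treesOfNumNodesEq] at ha hb
    obtain ⟨⟨x, y⟩, ⟨rfl, rfl⟩, rfl⟩ := ha
    obtain ⟨⟨x', y'⟩, ⟨rfl, rfl⟩, h'⟩ := hb
    simp at h'
    simp [h'] at h

theorem sum_antidiagonal_right_nil (g : BinaryTree Unit → ℕ) (n : ℕ) :
    ∑ p ∈ antidiagonal n, ∑ l ∈ treesOfNumNodesEq p.1, ∑ r ∈ treesOfNumNodesEq p.2,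
      (if r = .nil then g l else 0) = ∑ l ∈ treesOfNumNodesEq n, g l := by
  rw [sum_eq_single (n, 0)]
  · simp
  · rintro ⟨a, b⟩ hab hne
    refine sum_eq_zero fun l _ => sum_eq_zero fun r hr => if_neg ?_
    rintro rfl
    simp only [HasAntidiagonal.mem_antidiagonal, mem_treesOfNumNodesEq, numNodes] at hab hr
    subst hr
    simp at hab
    simp [hab] at hne
  · simp

theorem treeCount_diag_succ (j n : ℕ) : treeCount (j + 1) (j + 1) (n + 1) =
    treeCount (j + 1) (j + 1) n +
      ∑ p ∈ antidiagonal n, treeCount 0 0 p.1 * treeCountPos j j p.2 := by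
  simp_rw [treeCountPos_eq_sum, treeCount_eq_sum, sum_mul_sum]
  rw [sum_treesOfNumNodesEq_succ, ← sum_antidiagonal_right_nil]
  simp_rw [← sum_add_distrib]
  refine sum_congr rfl fun p _ => sum_congr rfl fun l _ => sum_congr rfl fun r _ => ?_
  have h1 := rightDepth_le_rightEdges l
  have h2 := rightDepth_le_rightEdges r
  by_cases hr : r = .nil
  · subst hr; simp [rightEdges, rightDepth]
  · simp only [rightEdges, rightDepth, hr, if_false]
    simp only [ne_eq, hr, not_false_eq_true, true_and, zero_add, ← ite_and, mul_ite,
      mul_one, mul_zero]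
    refine if_congr ?_ rfl rfl
    omega

theorem treeCount_zero_zero (n : ℕ) : treeCount 0 0 n = 1 := by
  induction n with
  | zero =>
    rw [treeCount_eq_sum, treesOfNumNodesEq_zero, sum_singleton]
    simp [rightEdges, rightDepth]
  | succ n ih =>
    refine Eq.trans ?_ ih
    rw [treeCount_eq_sum, treeCount_eq_sum, sum_treesOfNumNodesEq_succ,
      ← sum_antidiagonal_right_nil]
    refine sum_congr rfl fun p _ => sum_congr rfl fun l _ => sum_congr rfl fun r _ => ?_
    by_cases hr : r = .nil
    · subst hr; simp [rightEdges, rightDepth]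
    · simp [rightEdges, rightDepth, hr]

theorem treeCount_subdiag_succ (j n : ℕ) : treeCount (j + 3) (j + 2) (n + 1) =
    treeCount (j + 3) (j + 2) n +
      ∑ p ∈ antidiagonal n, (treeCount (j + 2) (j + 2) p.1 * treeCountPos 0 0 p.2 +
        treeCount 0 0 p.1 * treeCountPos (j + 2) (j + 1) p.2 +
        treeCount 1 1 p.1 * treeCountPos (j + 1) (j + 1) p.2) := by
  simp_rw [treeCountPos_eq_sum, treeCount_eq_sum, sum_mul_sum]
  rw [sum_treesOfNumNodesEq_succ, ← sum_antidiagonal_right_nil]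
  simp_rw [← sum_add_distrib]
  refine sum_congr rfl fun p _ => sum_congr rfl fun l _ => sum_congr rfl fun r _ => ?_
  have h1 := rightDepth_le_rightEdges l
  have h2 := rightDepth_le_rightEdges r
  have h3 := rightEdges_eq_zero_of_rightDepth l
  have h4 := rightEdges_eq_zero_of_rightDepth r
  by_cases hr : r = .nil
  · subst hr; simp [rightEdges, rightDepth]
  · simp only [rightEdges, rightDepth, hr, if_false]
    simp only [ne_eq, hr, not_false_eq_true, true_and, zero_add, ← ite_and, mul_ite,
      mul_one, mul_zero]
    split_ifs <;> omega

theorem treeCount_two_one_succ (n : ℕ) : treeCount 2 1 (n + 1) =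
    treeCount 2 1 n + ∑ p ∈ antidiagonal n, treeCount 1 1 p.1 * treeCountPos 0 0 p.2 := by
  simp_rw [treeCountPos_eq_sum, treeCount_eq_sum, sum_mul_sum]
  rw [sum_treesOfNumNodesEq_succ, ← sum_antidiagonal_right_nil]
  simp_rw [← sum_add_distrib]
  refine sum_congr rfl fun p _ => sum_congr rfl fun l _ => sum_congr rfl fun r _ => ?_
  have h1 := rightDepth_le_rightEdges l
  have h2 := rightDepth_le_rightEdges r
  have h3 := rightEdges_eq_zero_of_rightDepth l
  have h4 := rightEdges_eq_zero_of_rightDepth r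
  by_cases hr : r = .nil
  · subst hr; simp [rightEdges, rightDepth]
  · simp only [rightEdges, rightDepth, hr, if_false]
    simp only [ne_eq, hr, not_false_eq_true, true_and, zero_add, ← ite_and, mul_ite,
      mul_one, mul_zero]
    refine if_congr ?_ rfl rfl
    omega

theorem sum_antidiagonal_choose_mul_choose (p u s n : ℕ) (hs : s ≤ u) :
    ∑ x ∈ antidiagonal n, x.1.choose p * (x.2 + s).choose u = (n + s + 1).choose (p + u + 1) := by
  induction n generalizing p with
  | zero =>
    rcases p with _ | p
    · rcases hs.eq_or_lt with rfl | h
      · simp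
      · simp [Nat.choose_eq_zero_of_lt h, Nat.choose_eq_zero_of_lt (show s + 1 < u + 1 by omega)]
    · simp [Nat.choose_eq_zero_of_lt (show s + 1 < p + 1 + u + 1 by omega)]
  | succ n ih =>
    rw [Nat.sum_antidiagonal_succ]
    rcases p with _ | p
    · have := ih 0
      simp only [Nat.choose_zero_right, one_mul, zero_add] at this ⊢
      rw [this, show n + 1 + s + 1 = (n + s + 1) + 1 by ring, Nat.choose_succ_succ' (n + s + 1) u,
        show n + 1 + s = n + s + 1 by ring]
    · simp only [Nat.choose_zero_succ, zero_mul, zero_add, Nat.choose_succ_succ' _ p, add_mul,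
        sum_add_distrib, ih]
      rw [show n + 1 + s + 1 = (n + s + 1) + 1 by ring,
        show p + 1 + u + 1 = (p + u + 1) + 1 by ring, Nat.choose_succ_succ' (n + s + 1)]

theorem treeCount_diag_zero (j : ℕ) : treeCount (j + 1) (j + 1) 0 = 0 := by
  simp [treeCount, rightEdges]

theorem treeCount_diag (j n : ℕ) : treeCount (j + 1) (j + 1) n = (n + j).choose (2 * j + 2) := by
  induction j generalizing n with
  | zero =>
    induction n with
    | zero => simp [treeCount_diag_zero]
    | succ n ih =>
      rw [treeCount_diag_succ, ih]
      simp only [treeCount_zero_zero, one_mul, treeCountPos]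
      rcases n with _ | n
      · simp
      · rw [Nat.sum_antidiagonal_succ']
        simp [Nat.choose_succ_succ' (n + 1) 1]
        ring
  | succ j ihj =>
    induction n with
    | zero =>
      rw [treeCount_diag_zero, Nat.choose_eq_zero_of_lt (by omega)]
    | succ n ih =>
      rw [treeCount_diag_succ, ih]
      have key := sum_antidiagonal_choose_mul_choose 0 (2 * j + 2) j n (by omega)
      have : ∀ m, treeCountPos (j + 1) (j + 1) m = (m + j).choose (2 * j + 2) := by
        intro m
        rw [← ihj, treeCountPos]
        split_ifs with h
        · rw [h, treeCount_diag_zero]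
        · rfl
      simp only [treeCount_zero_zero, one_mul, this]
      simp only [Nat.choose_zero_right, one_mul] at key
      rw [key, show n + 1 + (j + 1) = n + j + 1 + 1 by ring,
        show 2 * (j + 1) + 2 = (2 * j + 3) + 1 by ring, Nat.choose_succ_succ' _ (2 * j + 3)]
      ring_nf

theorem treeCountPos_diag (j n : ℕ) :
    treeCountPos (j + 1) (j + 1) n = (n + j).choose (2 * j + 2) := by
  rw [← treeCount_diag, treeCountPos]
  split_ifs with h
  · rw [h, treeCount_diag_zero]
  · rfl

theorem sum_antidiagonal_treeCount_mul_treeCountPos_zero (j n : ℕ) :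
    ∑ p ∈ antidiagonal n, treeCount (j + 1) (j + 1) p.1 * treeCountPos 0 0 p.2 =
      (n + j).choose (2 * j + 3) := by
  rcases n with _ | n
  · simp [treeCountPos, Nat.choose_eq_zero_of_lt (show j < 2 * j + 3 by omega)]
  · rw [Nat.sum_antidiagonal_succ']
    have key := sum_antidiagonal_choose_mul_choose 0 (2 * j + 2) j n (by omega)
    rw [← Nat.sum_antidiagonal_swap] at key
    simp only [Prod.fst_swap, Prod.snd_swap, Nat.choose_zero_right, one_mul] at key
    simp [treeCountPos, treeCount_zero_zero, treeCount_diag, key]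
    ring_nf

theorem treeCount_subdiag_zero (j : ℕ) : treeCount (j + 2) (j + 1) 0 = 0 := by
  simp [treeCount, rightEdges]

theorem treeCount_subdiag (j n : ℕ) :
    treeCount (j + 2) (j + 1) n = (2 * j + 1) * (n + j).choose (2 * j + 4) := by
  induction j generalizing n with
  | zero =>
    induction n with
    | zero => simp [treeCount_subdiag_zero]
    | succ n ih =>
      rw [treeCount_two_one_succ, ih, sum_antidiagonal_treeCount_mul_treeCountPos_zero 0]
      simp [Nat.choose_succ_succ' n 3, add_comm]
  | succ j ihj =>
    induction n with
    | zero => rw [treeCount_subdiag_zero, Nat.choose_eq_zero_of_lt (by omega), mul_zero]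
    | succ n ih =>
      have : ∀ m, treeCountPos (j + 2) (j + 1) m = (2 * j + 1) * (m + j).choose (2 * j + 4) := by
        intro m
        rw [← ihj, treeCountPos]
        split_ifs with h
        · rw [h, treeCount_subdiag_zero]
        · rfl
      rw [treeCount_subdiag_succ, ih, sum_add_distrib, sum_add_distrib,
        sum_antidiagonal_treeCount_mul_treeCountPos_zero]
      have key := sum_antidiagonal_choose_mul_choose 0 (2 * j + 4) j n (by omega)
      simp only [Nat.choose_zero_right, one_mul] at key
      simp only [this, treeCountPos_diag, treeCount_diag 0, treeCount_zero_zero, one_mul,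
        ← mul_sum]
      have key' := sum_antidiagonal_choose_mul_choose 2 (2 * j + 2) j n (by omega)
      simp only [add_zero, mul_zero, zero_add]
      rw [key, key',
        show n + 1 + (j + 1) = n + j + 1 + 1 by ring,
        show 2 * (j + 1) + 4 = (2 * j + 5) + 1 by ring, Nat.choose_succ_succ' _ (2 * j + 5)]
      ring_nf

/-- The `231`-avoiding permutations of `ℕ` that permute `{0, …, n - 1}` and fix all other points. -/
structure IsAvoider_s12 (n : ℕ) (s : ℕ → ℕ) : Prop where
  injective : Function.Injective s
  lt_of_lt : ∀ i < n, s i < n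
  eq_self : ∀ i, n ≤ i → s i = i
  avoids : ∀ i j k, i < j → j < k → s k < s i → ¬ s i < s j

/-- The number of descents of `s` at positions below `n`. -/
def descentCount (n : ℕ) (s : ℕ → ℕ) : ℕ := ∑ i ∈ range n, if s (i + 1) < s i then 1 else 0

/-- The maximum drop of `s` at positions below `n`. -/
def dropSup (n : ℕ) (s : ℕ → ℕ) : ℕ := (range n).sup fun i => i - s i

/-- The sequence `s` on `m` points, followed by the value `m + r`, followed by the sequence `t` on
`r` points with its values shifted by `m`. -/
def joinAvoider (m r : ℕ) (s t : ℕ → ℕ) (i : ℕ) : ℕ :=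
  if i < m then s i else if i = m then m + r else if i ≤ m + r then m + t (i - (m + 1)) else i

theorem joinAvoider_of_lt {m r i : ℕ} (s t : ℕ → ℕ) (h : i < m) : joinAvoider m r s t i = s i :=
  if_pos h

theorem joinAvoider_self (m r : ℕ) (s t : ℕ → ℕ) : joinAvoider m r s t m = m + r := by
  simp [joinAvoider]

theorem joinAvoider_add {m r i : ℕ} (s t : ℕ → ℕ) (h : i < r) :
    joinAvoider m r s t (m + 1 + i) = m + t i := by
  rw [joinAvoider, if_neg (by omega), if_neg (by omega), if_pos (by omega)]
  congr 2; omega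

theorem joinAvoider_of_gt {m r i : ℕ} (s t : ℕ → ℕ) (h : m + r < i) :
    joinAvoider m r s t i = i := by
  rw [joinAvoider, if_neg (by omega), if_neg (by omega), if_neg (by omega)]

section join

variable {m r : ℕ} {s t : ℕ → ℕ}

theorem IsAvoider_s12.join_cases (hs : IsAvoider_s12 m s) (ht : IsAvoider_s12 r t) (i : ℕ) :
    (i < m ∧ joinAvoider m r s t i = s i ∧ s i < m) ∨
    (i = m ∧ joinAvoider m r s t i = m + r) ∨
    (∃ i' < r, i = m + 1 + i' ∧ joinAvoider m r s t i = m + t i' ∧ t i' < r) ∨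
    (m + r < i ∧ joinAvoider m r s t i = i) := by
  rcases lt_trichotomy i m with h | h | h
  · exact .inl ⟨h, joinAvoider_of_lt s t h, hs.lt_of_lt i h⟩
  · exact .inr (.inl ⟨h, h ▸ joinAvoider_self m r s t⟩)
  · rcases le_or_gt i (m + r) with h' | h'
    · obtain ⟨i', rfl⟩ := Nat.exists_eq_add_of_le h
      exact .inr (.inr (.inl ⟨i', by omega, rfl, joinAvoider_add s t (by omega),
        ht.lt_of_lt i' (by omega)⟩))
    · exact .inr (.inr (.inr ⟨h', joinAvoider_of_gt s t h'⟩))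

theorem IsAvoider_s12.join (hs : IsAvoider_s12 m s) (ht : IsAvoider_s12 r t) :
    IsAvoider_s12 (m + r + 1) (joinAvoider m r s t) where
  injective i j h := by
    rcases hs.join_cases ht i with ⟨h1, h2, h3⟩ | ⟨h1, h2⟩ | ⟨i', h1, h2, h3, h4⟩ | ⟨h1, h2⟩ <;>
    rcases hs.join_cases ht j with ⟨h5, h6, h7⟩ | ⟨h5, h6⟩ | ⟨j', h5, h6, h7, h8⟩ | ⟨h5, h6⟩ <;>
    try omega
    · exact hs.injective (by omega)
    · have := @ht.injective i' j' (by omega)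
      omega
  lt_of_lt i hi := by
    rcases hs.join_cases ht i with ⟨h1, h2, h3⟩ | ⟨h1, h2⟩ | ⟨i', h1, h2, h3, h4⟩ | ⟨h1, h2⟩ <;>
    omega
  eq_self i hi := joinAvoider_of_gt s t (by omega)
  avoids i j k hij hjk hki hik := by
    rcases hs.join_cases ht i with ⟨h1, h2, h3⟩ | ⟨h1, h2⟩ | ⟨i', h1, h2, h3, h4⟩ | ⟨h1, h2⟩ <;>
    rcases hs.join_cases ht j with ⟨h5, h6, h7⟩ | ⟨h5, h6⟩ | ⟨j', h5, h6, h7, h8⟩ | ⟨h5, h6⟩ <;>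
    try omega
    all_goals rcases hs.join_cases ht k with
      ⟨h9, h10, h11⟩ | ⟨h9, h10⟩ | ⟨k', h9, h10, h11, h12⟩ | ⟨h9, h10⟩ <;> try omega
    · exact hs.avoids i j k hij hjk (by omega) (by omega)
    · exact ht.avoids i' j' k' (by omega) (by omega) (by omega) (by omega)

theorem IsAvoider_s12.descentCount_join (hs : IsAvoider_s12 m s) (ht : IsAvoider_s12 r t) :
    descentCount (m + r + 1) (joinAvoider m r s t) =
      descentCount m s + descentCount r t + if r = 0 then 0 else 1 := by
  have e : m + r + 1 = m + 1 + r := by ring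
  simp only [descentCount]
  rw [e, sum_range_add, sum_range_succ, add_assoc, add_assoc, add_comm (∑ i ∈ range r, _)]
  congr 1
  · refine sum_congr rfl fun i hi => ?_
    rw [mem_range] at hi
    have h1 := hs.lt_of_lt i hi
    rw [joinAvoider_of_lt s t hi]
    rcases (Nat.succ_le_of_lt hi).lt_or_eq with h | h
    · rw [joinAvoider_of_lt s t h]
    · rw [show i + 1 = m from h, joinAvoider_self, hs.eq_self m le_rfl, if_neg (by omega),
        if_neg (by omega)]
  congr 1
  · rw [joinAvoider_self]
    rcases Nat.eq_zero_or_pos r with rfl | h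
    · rw [joinAvoider_of_gt s t (by omega)]
      simp
    · have := joinAvoider_add (m := m) s t h
      have h0 := ht.lt_of_lt 0 h
      rw [add_zero] at this
      rw [this, if_pos (by omega), if_neg (by omega)]
  · refine sum_congr rfl fun i hi => ?_
    rw [mem_range] at hi
    have h1 := ht.lt_of_lt i hi
    rw [joinAvoider_add s t hi]
    rcases (Nat.succ_le_of_lt hi).lt_or_eq with h | h
    · rw [add_assoc (m + 1), joinAvoider_add s t (show i + 1 < r from h)]
      exact if_congr (by omega) rfl rfl
    · rw [Nat.succ_eq_add_one] at h
      rw [joinAvoider_of_gt s t (by omega), ht.eq_self (i + 1) h.ge, if_neg (by omega),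
        if_neg (by omega)]

theorem dropSup_le_iff {n k : ℕ} {s : ℕ → ℕ} : dropSup n s ≤ k ↔ ∀ i < n, i - s i ≤ k := by
  simp [dropSup, Finset.sup_le_iff]

theorem IsAvoider_s12.dropSup_join (hs : IsAvoider_s12 m s) (ht : IsAvoider_s12 r t) :
    dropSup (m + r + 1) (joinAvoider m r s t) =
      max (dropSup m s) (dropSup r t + if r = 0 then 0 else 1) := by
  refine eq_of_forall_ge_iff fun k => ?_
  rw [max_le_iff, dropSup_le_iff, dropSup_le_iff]
  have h1 : dropSup r t + (if r = 0 then 0 else 1) ≤ k ↔ ∀ i < r, i + 1 - t i ≤ k := by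
    split_ifs with h
    · simp [h, dropSup]
    · constructor
      · intro hk i hi
        have := (dropSup_le_iff (s := t)).mp le_rfl i hi
        omega
      · intro hk
        have h0 := hk (r - 1) (by omega)
        have h2 := ht.lt_of_lt (r - 1) (by omega)
        have : dropSup r t ≤ k - 1 := dropSup_le_iff.mpr fun i hi => by
          have := hk i hi
          omega
        omega
  rw [h1]
  constructor
  · refine fun h => ⟨fun i hi => ?_, fun i hi => ?_⟩
    · have := h i (by omega)
      rwa [joinAvoider_of_lt s t hi] at this
    · have := h (m + 1 + i) (by omega)
      rw [joinAvoider_add s t hi] at this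
      omega
  · rintro ⟨h, h'⟩ i hi
    rcases hs.join_cases ht i with ⟨h1, h2, h3⟩ | ⟨h1, h2⟩ | ⟨i', h1, h2, h3, h4⟩ | ⟨h1, h2⟩
    · rw [h2]; exact h i h1
    · omega
    · have := h' i' h1
      omega
    · omega

theorem IsAvoider_s12.join_injective {m' r' : ℕ} {s' t' : ℕ → ℕ} (hs : IsAvoider_s12 m s)
    (ht : IsAvoider_s12 r t) (hs' : IsAvoider_s12 m' s') (ht' : IsAvoider_s12 r' t') (hm : m + r = m' + r')
    (h : joinAvoider m r s t = joinAvoider m' r' s' t') : m = m' ∧ r = r' ∧ s = s' ∧ t = t' := by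
  obtain rfl : m = m' := by
    refine (hs'.join ht').injective ?_
    rw [joinAvoider_self, ← h, joinAvoider_self, hm]
  obtain rfl : r = r' := by omega
  refine ⟨rfl, rfl, funext fun i => ?_, funext fun i => ?_⟩
  · rcases lt_or_ge i m with hi | hi
    · rw [← joinAvoider_of_lt (r := r) s t hi, h, joinAvoider_of_lt _ _ hi]
    · rw [hs.eq_self i hi, hs'.eq_self i hi]
  · rcases lt_or_ge i r with hi | hi
    · have := congrFun h (m + 1 + i)
      rw [joinAvoider_add _ _ hi, joinAvoider_add _ _ hi] at this
      omega
    · rw [ht.eq_self i hi, ht'.eq_self i hi]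

end join

theorem IsAvoider_s12.zero {s : ℕ → ℕ} (h : IsAvoider_s12 0 s) : s = id :=
  funext fun i => h.eq_self i (Nat.zero_le i)

theorem IsAvoider_s12.id_zero : IsAvoider_s12 0 id where
  injective := Function.injective_id
  lt_of_lt := by simp
  eq_self := by simp
  avoids := by simp only [id]; omega

theorem IsAvoider_s12.exists_eq_max {n : ℕ} {s : ℕ → ℕ} (h : IsAvoider_s12 (n + 1) s) :
    ∃ m ≤ n, s m = n := by
  have := surj_on_of_inj_on_of_card_le (s := range (n + 1)) (t := range (n + 1)) (fun i _ => s i)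
    (fun i hi => mem_range.mpr (h.lt_of_lt i (mem_range.mp hi)))
    (fun i j _ _ hij => h.injective hij) le_rfl n (by simp)
  obtain ⟨m, hm, h'⟩ := this
  exact ⟨m, by simpa [Nat.lt_succ_iff] using hm, h'.symm⟩

theorem IsAvoider_s12.exists_join {n : ℕ} {s : ℕ → ℕ} (h : IsAvoider_s12 (n + 1) s) :
    ∃ m r s₁ s₂, m + r = n ∧ IsAvoider_s12 m s₁ ∧ IsAvoider_s12 r s₂ ∧ s = joinAvoider m r s₁ s₂ := by
  obtain ⟨m, hmn, hm⟩ := h.exists_eq_max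
  have hne : ∀ i, i ≠ m → s i ≠ n := fun i hi h' => hi (h.injective (h'.trans hm.symm))
  have hcross : ∀ i k, i < m → m < k → s i < s k := by
    intro i k hi hk
    have h1 := h.avoids i m k hi hk
    have h2 := h.lt_of_lt i (by omega)
    have h3 := hne i hi.ne
    have h4 : s i ≠ s k := h.injective.ne (by omega)
    omega
  have hlow : ∀ i < m, s i < m := by
    intro i hi
    have hc := card_le_card_of_injOn (s := Ioc m n) (t := Ioo (s i) n) s
      (by
        intro k hk
        have hk := mem_Ioc.mp (mem_coe.mp hk)
        have := h.lt_of_lt k (by omega)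
        have := hne k (by omega)
        exact mem_coe.mpr (mem_Ioo.mpr ⟨hcross i k hi hk.1, by omega⟩))
      h.injective.injOn
    have h2 := h.lt_of_lt i (by omega)
    have h3 := hne i hi.ne
    rw [Nat.card_Ioc, Nat.card_Ioo] at hc
    omega
  have hhigh : ∀ k, m < k → m ≤ s k := by
    intro k hk
    have hc := card_le_card_of_injOn (s := range m) (t := range (s k)) s
      (fun i hi => mem_coe.mpr (mem_range.mpr (hcross i k (mem_range.mp (mem_coe.mp hi)) hk)))
      h.injective.injOn
    simpa using hc
  obtain ⟨r, rfl⟩ := Nat.exists_eq_add_of_le hmn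
  have hr : ∀ i < r, s (m + 1 + i) < m + r := fun i hi => by
    have := h.lt_of_lt (m + 1 + i) (by omega)
    have := hne (m + 1 + i) (by omega)
    omega
  refine ⟨m, r, fun i => if i < m then s i else i,
    fun i => s (m + 1 + i) - m - if i < r then 0 else 1,
    rfl, ⟨?_, ?_, ?_, ?_⟩, ⟨?_, ?_, ?_, ?_⟩, ?_⟩
  · intro i j hij
    have := hlow i
    have := hlow j
    dsimp only at hij
    split_ifs at hij
    · exact h.injective hij
    all_goals omega
  · intro i hi
    simpa only [if_pos hi] using hlow i hi
  · intro i hi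
    exact if_neg (by omega)
  · intro i j k hij hjk hki hik
    have := hlow i
    have := hlow j
    have := hlow k
    have := h.avoids i j k hij hjk
    split_ifs at hki hik <;> omega
  · intro i j hij
    have h1 := hhigh (m + 1 + i) (by omega)
    have h2 := hhigh (m + 1 + j) (by omega)
    have h3 := hr i
    have h4 := hr j
    have h5 := h.eq_self (m + 1 + i)
    have h6 := h.eq_self (m + 1 + j)
    dsimp only at hij
    have : s (m + 1 + i) = s (m + 1 + j) := by split_ifs at hij <;> omega
    have := h.injective this
    omega
  · intro i hi
    have := hr i hi
    have h1 := hhigh (m + 1 + i) (by omega)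
    simp only [if_pos hi]
    omega
  · intro i hi
    have h5 := h.eq_self (m + 1 + i)
    simp only [if_neg hi.not_gt]
    omega
  · intro i j k hij hjk hki hik
    have h1 := hhigh (m + 1 + i) (by omega)
    have h2 := hhigh (m + 1 + j) (by omega)
    have h7 := hhigh (m + 1 + k) (by omega)
    have h3 := hr i
    have h4 := hr j
    have h8 := hr k
    have h5 := h.eq_self (m + 1 + i)
    have h6 := h.eq_self (m + 1 + j)
    have h9 := h.eq_self (m + 1 + k)
    have := h.avoids (m + 1 + i) (m + 1 + j) (m + 1 + k) (by omega) (by omega)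
    split_ifs at hki hik <;> omega
  · funext i
    rcases lt_trichotomy i m with hi | hi | hi
    · rw [joinAvoider_of_lt _ _ hi, if_pos hi]
    · rw [hi, joinAvoider_self, hm]
    · obtain ⟨i, rfl⟩ := Nat.exists_eq_add_of_le (Nat.succ_le_of_lt hi)
      rw [Nat.succ_eq_add_one]
      rcases lt_or_ge i r with h' | h'
      · rw [joinAvoider_add _ _ h', if_pos h']
        have := hhigh (m + 1 + i) (by omega)
        omega
      · rw [joinAvoider_of_gt _ _ (by omega), h.eq_self _ (by omega)]

/-- The `231`-avoiding permutation associated with a binary tree. -/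
def treeAvoider : BinaryTree Unit → ℕ → ℕ
  | .nil => id
  | .node _ l r => joinAvoider l.numNodes r.numNodes (treeAvoider l) (treeAvoider r)

theorem isAvoider_treeAvoider (t : BinaryTree Unit) : IsAvoider_s12 t.numNodes (treeAvoider t) := by
  induction t with
  | nil => exact .id_zero
  | node _ l r hl hr => exact hl.join hr

theorem BinaryTree.numNodes_eq_zero_iff (t : BinaryTree Unit) : t.numNodes = 0 ↔ t = .nil := by
  cases t <;> simp

theorem descentCount_treeAvoider (t : BinaryTree Unit) :
    descentCount t.numNodes (treeAvoider t) = rightEdges t := by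
  induction t with
  | nil => rfl
  | node _ l r hl hr =>
    rw [numNodes, treeAvoider,
      (isAvoider_treeAvoider l).descentCount_join (isAvoider_treeAvoider r), hl, hr, rightEdges]
    simp only [numNodes_eq_zero_iff]

theorem dropSup_treeAvoider (t : BinaryTree Unit) :
    dropSup t.numNodes (treeAvoider t) = rightDepth t := by
  induction t with
  | nil => rfl
  | node _ l r hl hr =>
    rw [numNodes, treeAvoider,
      (isAvoider_treeAvoider l).dropSup_join (isAvoider_treeAvoider r), hl, hr, rightDepth]
    simp only [numNodes_eq_zero_iff]

theorem treeAvoider_injective_of_numNodes_eq (t t' : BinaryTree Unit)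
    (hn : t.numNodes = t'.numNodes) (h : treeAvoider t = treeAvoider t') : t = t' := by
  induction t generalizing t' with
  | nil => exact ((numNodes_eq_zero_iff t').mp hn.symm).symm
  | node _ l r hl hr =>
    cases t' with
    | nil => simp at hn
    | node _ l' r' =>
      obtain ⟨h1, h2, h3, h4⟩ := (isAvoider_treeAvoider l).join_injective
        (isAvoider_treeAvoider r) (isAvoider_treeAvoider l') (isAvoider_treeAvoider r')
        (by simpa using hn) h
      rw [hl l' h1 h3, hr r' h2 h4]

theorem IsAvoider_s12.exists_treeAvoider {n : ℕ} {s : ℕ → ℕ} (h : IsAvoider_s12 n s) :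
    ∃ t : BinaryTree Unit, t.numNodes = n ∧ treeAvoider t = s := by
  induction n using Nat.strong_induction_on generalizing s with
  | _ n ih =>
    rcases n with _ | n
    · exact ⟨.nil, rfl, h.zero.symm⟩
    · obtain ⟨m, r, s₁, s₂, hmr, h₁, h₂, rfl⟩ := h.exists_join
      obtain ⟨l, rfl, rfl⟩ := ih m (by omega) h₁
      obtain ⟨r, rfl, rfl⟩ := ih r (by omega) h₂
      exact ⟨.node () l r, by simp [hmr], rfl⟩

theorem ncard_isAvoider (n j k : ℕ) :
    {s | IsAvoider_s12 n s ∧ descentCount n s = j ∧ dropSup n s = k}.ncard = treeCount j k n := by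
  rw [treeCount, ← Set.ncard_coe_finset, ← Set.InjOn.ncard_image (f := treeAvoider)]
  · congr 1
    ext s
    simp only [Set.mem_ofPred_eq, Set.mem_image, coe_filter, mem_treesOfNumNodesEq]
    constructor
    · rintro ⟨h, rfl, rfl⟩
      obtain ⟨t, rfl, rfl⟩ := h.exists_treeAvoider
      exact ⟨t, ⟨rfl, (descentCount_treeAvoider t).symm, (dropSup_treeAvoider t).symm⟩, rfl⟩
    · rintro ⟨t, ⟨rfl, rfl, rfl⟩, rfl⟩
      exact ⟨isAvoider_treeAvoider t, descentCount_treeAvoider t, dropSup_treeAvoider t⟩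
  · intro t ht t' ht' h
    simp only [coe_filter, mem_treesOfNumNodesEq, Set.mem_ofPred_eq] at ht ht'
    exact treeAvoider_injective_of_numNodes_eq t t' (ht.1.trans ht'.1.symm) h

/-- The extension of a permutation of `Fin n` to `ℕ` fixing all points from `n` on. -/
def extendPerm {n : ℕ} (σ : Equiv.Perm (Fin n)) (i : ℕ) : ℕ := if h : i < n then σ ⟨i, h⟩ else i

section extend

variable {n : ℕ} (σ : Equiv.Perm (Fin n))

theorem extendPerm_coe (i : Fin n) : extendPerm σ i = σ i := by
  simp [extendPerm]

theorem extendPerm_of_le {i : ℕ} (h : n ≤ i) : extendPerm σ i = i :=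
  dif_neg h.not_gt

theorem extendPerm_lt {i : ℕ} (h : i < n) : extendPerm σ i < n := by
  simp [extendPerm, h]

theorem extendPerm_injective : Function.Injective (extendPerm (n := n)) := by
  intro σ τ h
  ext i
  rw [← extendPerm_coe, h, extendPerm_coe]

theorem injective_extendPerm : Function.Injective (extendPerm σ) := by
  intro i j h
  rcases lt_or_ge i n with hi | hi <;> rcases lt_or_ge j n with hj | hj
  · have h1 := extendPerm_coe σ ⟨i, hi⟩
    have h2 := extendPerm_coe σ ⟨j, hj⟩
    have := σ.injective (Fin.ext (h1.symm.trans (h.trans h2)))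
    simpa using this
  · have h1 := extendPerm_lt σ hi
    have h2 := extendPerm_of_le σ hj
    omega
  · have h1 := extendPerm_lt σ hj
    have h2 := extendPerm_of_le σ hi
    omega
  · rwa [extendPerm_of_le σ hi, extendPerm_of_le σ hj] at h

theorem isAvoider_extendPerm_iff : IsAvoider_s12 n (extendPerm σ) ↔ avoids231 σ := by
  constructor
  · rintro h ⟨i, j, k, hij, hjk, hki, hik⟩
    refine h.avoids i j k hij hjk ?_ ?_ <;> simpa only [extendPerm_coe]
  · refine fun h => ⟨injective_extendPerm σ, fun i => extendPerm_lt σ,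
      fun i => extendPerm_of_le σ, fun i j k hij hjk hki hik => ?_⟩
    rcases lt_or_ge k n with hk | hk
    · refine h ⟨⟨i, by omega⟩, ⟨j, by omega⟩, ⟨k, hk⟩, hij, hjk, ?_, ?_⟩ <;>
      rw [Fin.lt_def, ← extendPerm_coe, ← extendPerm_coe] <;> assumption
    · have h1 := extendPerm_of_le σ hk
      have h2 := extendPerm_lt σ (i := i)
      have h3 := extendPerm_of_le σ (i := i)
      omega

theorem descentCount_extendPerm : descentCount n (extendPerm σ) = des σ := by
  classical
  rw [des, Nat.card_eq_fintype_card, Fintype.card_subtype, descentCount, card_filter,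
    sum_range (fun i => if extendPerm σ (i + 1) < extendPerm σ i then 1 else 0)]
  refine sum_congr rfl fun i _ => if_congr ?_ rfl rfl
  rw [extendPerm_coe]
  constructor
  · intro h
    rcases lt_or_ge (i + 1 : ℕ) n with hi | hi
    · refine ⟨hi, ?_⟩
      rw [Fin.lt_def, ← extendPerm_coe]
      exact h
    · rw [extendPerm_of_le σ hi] at h
      omega
  · rintro ⟨hi, h⟩
    rw [Fin.lt_def, ← extendPerm_coe] at h
    exact h

theorem dropSup_extendPerm : dropSup n (extendPerm σ) = maxDrop σ := by
  refine eq_of_forall_ge_iff fun k => ?_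
  rw [dropSup_le_iff, maxDrop, Finset.sup_le_iff]
  constructor
  · intro h i _
    rw [← extendPerm_coe]
    exact h i i.2
  · intro h i hi
    have := h ⟨i, hi⟩ (mem_univ _)
    rwa [← extendPerm_coe] at this

end extend

theorem IsAvoider_s12.exists_extendPerm {n : ℕ} {s : ℕ → ℕ} (h : IsAvoider_s12 n s) :
    ∃ σ : Equiv.Perm (Fin n), extendPerm σ = s := by
  have hinj : Function.Injective fun i : Fin n => (⟨s i, h.lt_of_lt i i.2⟩ : Fin n) := by
    intro i j hij
    exact Fin.ext (h.injective (Fin.mk.inj_iff.mp hij))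
  refine ⟨Equiv.ofBijective _ (Finite.injective_iff_bijective.mp hinj), funext fun i => ?_⟩
  rcases lt_or_ge i n with hi | hi
  · simp [extendPerm, hi]
  · rw [extendPerm_of_le _ hi, h.eq_self i hi]

theorem card_avoids231_eq_treeCount (n j k : ℕ) :
    Nat.card {σ : Equiv.Perm (Fin n) // avoids231 σ ∧ des σ = j ∧ maxDrop σ = k} =
      treeCount j k n := by
  rw [← ncard_isAvoider]
  change Set.ncard {σ : Equiv.Perm (Fin n) | avoids231 σ ∧ des σ = j ∧ maxDrop σ = k} = _
  rw [← Set.ncard_image_of_injective _ extendPerm_injective]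
  congr 1
  ext s
  simp only [Set.mem_image, Set.mem_ofPred_eq]
  constructor
  · rintro ⟨σ, ⟨h, rfl, rfl⟩, rfl⟩
    exact ⟨(isAvoider_extendPerm_iff σ).mpr h, descentCount_extendPerm σ, dropSup_extendPerm σ⟩
  · rintro ⟨h, rfl, rfl⟩
    obtain ⟨σ, rfl⟩ := h.exists_extendPerm
    exact ⟨σ, ⟨(isAvoider_extendPerm_iff σ).mp h, (descentCount_extendPerm σ).symm,
      (dropSup_extendPerm σ).symm⟩, rfl⟩

theorem card_maxDrop_eq_des_sub_one (n j : ℕ) (hj : 2 ≤ j) (hn : 1 ≤ n) :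
    Nat.card {σ : Equiv.Perm (Fin n) // avoids231 σ ∧ des σ = j ∧ maxDrop σ = j - 1} =
      (2 * j - 3) * (n + j - 2).choose (2 * j) := by
  obtain ⟨i, rfl⟩ := Nat.exists_eq_add_of_le' hj
  rw [card_avoids231_eq_treeCount]
  exact treeCount_subdiag i n
end

section
/- For all j ≥ 2 and all n ≥ 1, the number a_{n,j}^{(j−2)} of 231-avoiding permutations σ of {1,…,n} with des(σ) = j and md(σ) ≤ j−2 satisfies n · a_{n,j}^{(j−2)} = C(n, j)·C(n, j+1) − n·C(n+j−1, 2j) − n·(2j−3)·C(n+j−2, 2j). -/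
namespace Perm231

open BinaryTree

/-- The number of descents of a word. -/
def listDes : List ℕ → ℕ
  | [] => 0
  | [_] => 0
  | x :: y :: l => (if y < x then 1 else 0) + listDes (y :: l)

/-- When the letters of the word are placed at positions `s, s + 1, …`, every drop
(position minus letter) is at most `k`. -/
def DropLE (k : ℕ) : ℕ → List ℕ → Prop
  | _, [] => True
  | s, x :: l => s ≤ x + k ∧ DropLE k (s + 1) l

/-- The word avoids the pattern 231. -/
def ListAvoids (l : List ℕ) : Prop :=
  ∀ x y z, [x, y, z].Sublist l → ¬ (z < x ∧ x < y)

/-- The 231-avoiding word of a binary tree: the largest letter sits at the root, and the letters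
of the left subtree are smaller than those of the right subtree. -/
def word : BinaryTree Unit → List ℕ
  | nil => []
  | node _ l r => word l ++ (l.numNodes + r.numNodes) :: (word r).map (l.numNodes + ·)

/-- The number of descents of the word of a tree. -/
def treeDes : BinaryTree Unit → ℕ
  | nil => 0
  | node _ l r => treeDes l + if r = nil then 0 else treeDes r + 1

/-- The maximum drop of the word of a tree. -/
def treeDrop : BinaryTree Unit → ℕ
  | nil => 0
  | node _ l r => max (treeDrop l) (if r = nil then 0 else treeDrop r + 1)

theorem length_word (T : BinaryTree Unit) : (word T).length = T.numNodes := by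
  induction T with
  | nil => rfl
  | node _ l r hl hr => simp [word, numNodes, hl, hr]; omega

theorem word_perm (T : BinaryTree Unit) : (word T).Perm (List.range T.numNodes) := by
  induction T with
  | nil => simp [word, numNodes]
  | node _ l r hl hr =>
    rw [word, numNodes, List.range_succ, List.range_add]
    refine List.perm_middle.trans (List.Perm.trans ?_ (List.perm_append_singleton _ _).symm)
    exact ((hl.append (hr.map _))).cons _

theorem mem_word {T : BinaryTree Unit} {x : ℕ} : x ∈ word T ↔ x < T.numNodes := by
  rw [(word_perm T).mem_iff, List.mem_range]

theorem word_eq_nil {T : BinaryTree Unit} : word T = [] ↔ T = nil := by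
  cases T <;> simp [word]

theorem numNodes_eq_zero {T : BinaryTree Unit} : T.numNodes = 0 ↔ T = nil := by
  cases T <;> simp [numNodes]

theorem ListAvoids.of_sublist {l l' : List ℕ} (h : ListAvoids l) (h' : l'.Sublist l) :
    ListAvoids l' := fun x y z hs => h x y z (hs.trans h')

theorem listAvoids_map_add {m : ℕ} {l : List ℕ} : ListAvoids (l.map (m + ·)) ↔ ListAvoids l := by
  constructor
  · intro h x y z hs hxy
    exact h _ _ _ (by simpa using hs.map (m + ·)) (by simpa using hxy)
  · intro h x y z hs hxy
    obtain ⟨l', hl', e⟩ := List.sublist_map_iff.1 hs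
    match l', e with
    | [a, b, c], e =>
      simp only [List.map_cons, List.map_nil, List.cons.injEq] at e
      exact h a b c hl' (by omega)

theorem listAvoids_append_cons {l r : List ℕ} {m : ℕ} (hl : ∀ x ∈ l, x < m)
    (hlr : ∀ x ∈ l, ∀ y ∈ r, x < y) (hal : ListAvoids l)
    (hr : ∀ x ∈ r, x < m) (har : ListAvoids r) : ListAvoids (l ++ m :: r) := by
  intro x y z hs hxy
  obtain ⟨l₁, l₂, e, h₁, h₂⟩ := List.sublist_append_iff.1 hs
  have hm : ∀ w ∈ m :: r, ∀ v ∈ l, v < w := by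
    simp only [List.mem_cons]; grind
  match l₁, e with
  | [], e =>
    simp only [List.nil_append] at e
    subst e
    rcases List.sublist_cons_iff.1 h₂ with h | ⟨t, e, h⟩
    · exact har _ _ _ h hxy
    · simp only [List.cons.injEq] at e
      obtain ⟨rfl, rfl⟩ := e
      have := hr y (h.subset (by simp))
      omega
  | [a], e =>
    simp at e
    have h3 := h₁.subset (a := a) (by simp)
    have := hm z (h₂.subset (by simp [← e.2])) a h3
    omega
  | [a, b], e =>
    simp at e
    have h3 := h₁.subset (a := a) (by simp)
    have := hm z (h₂.subset (by simp [← e.2.2])) a h3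
    omega
  | [a, b, c], e =>
    simp at e
    obtain ⟨rfl, rfl, rfl, -⟩ := e
    exact hal _ _ _ h₁ hxy
  | a :: b :: c :: d :: t, e => simp at e

theorem word_listAvoids (T : BinaryTree Unit) : ListAvoids (word T) := by
  induction T with
  | nil => intro x y z hs; simp [word] at hs
  | node _ l r hl hr =>
    refine listAvoids_append_cons ?_ ?_ hl ?_ (listAvoids_map_add.2 hr)
    · intro x hx; rw [mem_word] at hx; omega
    · intro x hx y hy
      rw [mem_word] at hx
      simp only [List.mem_map] at hy
      omega
    · intro y hy
      simp only [List.mem_map, mem_word] at hy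
      omega

theorem word_injective : Function.Injective word := by
  intro T
  induction T with
  | nil => intro T' h; exact (word_eq_nil.1 h.symm).symm
  | node _ l r hl hr =>
    intro T' h
    cases T' with
    | nil => simp [word] at h
    | node _ l' r' =>
      have hlen := congrArg List.length h
      simp only [length_word, numNodes] at hlen
      have hlen' : l'.numNodes + r'.numNodes = l.numNodes + r.numNodes := by omega
      rw [word, word, List.append_cons_inj_of_notMem] at h
      · obtain ⟨h1, -, h2⟩ := h
        have e := hl h1
        subst e
        rw [hr ((List.map_injective_iff.2 (add_right_injective _)) h2)]
      · rw [mem_word]; omega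
      · simp only [List.mem_map, mem_word]; omega

theorem listDes_map_add (m : ℕ) (l : List ℕ) : listDes (l.map (m + ·)) = listDes l := by
  induction l using listDes.induct <;> simp_all [listDes]

theorem listDes_cons_of_lt {m : ℕ} {r : List ℕ} (hr : ∀ x ∈ r, x < m) :
    listDes (m :: r) = if r = [] then 0 else listDes r + 1 := by
  cases r with
  | nil => simp [listDes]
  | cons x r => simp [listDes, hr x (by simp), add_comm]

theorem listDes_append_cons {l r : List ℕ} {m : ℕ} (hl : ∀ x ∈ l, x < m) :
    listDes (l ++ m :: r) = listDes l + listDes (m :: r) := by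
  induction l using listDes.induct with
  | case1 => simp [listDes]
  | case2 x =>
    have := hl x (by simp)
    simp [listDes, this.le]
  | case3 x y l ih =>
    have := ih (fun z hz => hl z (List.mem_cons_of_mem _ hz))
    simp only [List.cons_append] at this ⊢
    rw [listDes, listDes, this, add_assoc]

theorem listDes_word (T : BinaryTree Unit) : listDes (word T) = treeDes T := by
  induction T with
  | nil => rfl
  | node _ l r hl hr =>
    rw [word, listDes_append_cons, listDes_cons_of_lt, treeDes, hl, listDes_map_add, hr]
    · simp [word_eq_nil]
    · intro y hy
      simp only [List.mem_map, mem_word] at hy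
      omega
    · intro x hx; rw [mem_word] at hx; omega

theorem dropLE_append {k s : ℕ} {l r : List ℕ} :
    DropLE k s (l ++ r) ↔ DropLE k s l ∧ DropLE k (s + l.length) r := by
  induction l generalizing s with
  | nil => simp [DropLE]
  | cons x l ih => simp [DropLE, ih, and_assoc, add_assoc, add_comm 1]

theorem dropLE_map_add {k s m : ℕ} {l : List ℕ} :
    DropLE k (m + s) (l.map (m + ·)) ↔ DropLE k s l := by
  induction l generalizing s with
  | nil => simp [DropLE]
  | cons x l ih => simp only [List.map_cons, DropLE, add_assoc, ih]; simp

theorem dropLE_succ {k s : ℕ} {l : List ℕ} :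
    DropLE (k + 1) (s + 1) l ↔ DropLE k s l := by
  induction l generalizing s with
  | nil => simp [DropLE]
  | cons x l ih => rw [DropLE, DropLE, ih, and_congr_left']; omega

theorem le_of_dropLE_of_zero_mem {k s : ℕ} {l : List ℕ} (h : DropLE k s l) (h0 : 0 ∈ l) :
    s ≤ k := by
  induction l generalizing s with
  | nil => simp at h0
  | cons x l ih =>
    rcases List.mem_cons.1 h0 with rfl | h0
    · simpa using h.1
    · exact (Nat.le_succ s).trans (ih h.2 h0)

theorem dropLE_word {T : BinaryTree Unit} {k : ℕ} : DropLE k 0 (word T) ↔ treeDrop T ≤ k := by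
  induction T generalizing k with
  | nil => simp [DropLE, word, treeDrop]
  | node _ l r hl hr =>
    rw [word, dropLE_append, hl, treeDrop, max_le_iff, DropLE, length_word, zero_add,
      dropLE_map_add]
    refine and_congr_right fun _ => ?_
    rw [and_iff_right (by omega)]
    split_ifs with h
    · simp [h, word, DropLE]
    · cases k with
      | zero =>
        simp only [Nat.le_zero, Nat.add_eq_zero_iff, one_ne_zero, and_false, iff_false]
        intro h'
        have := le_of_dropLE_of_zero_mem h'
          (mem_word.2 (Nat.pos_of_ne_zero (mt numNodes_eq_zero.1 h)))
        omega
      | succ k => rw [show (1 : ℕ) = 0 + 1 from rfl, dropLE_succ, hr, zero_add, Nat.succ_le_succ_iff]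

theorem left_perm_range {n : ℕ} {l r : List ℕ} (h : (l ++ r).Perm (List.range n))
    (hlr : ∀ x ∈ l, ∀ y ∈ r, x < y) :
    l.Perm (List.range l.length) ∧ r.Perm ((List.range r.length).map (l.length + ·)) := by
  have hl := List.mergeSort_perm l (· ≤ ·)
  have hr := List.mergeSort_perm r (· ≤ ·)
  have hs : List.mergeSort l (· ≤ ·) ++ List.mergeSort r (· ≤ ·) = List.range n := by
    refine List.Perm.eq_of_pairwise' (r := (· ≤ ·)) ?_ ?_ ((hl.append hr).trans h)
    · rw [List.pairwise_append]
      refine ⟨by simpa using List.pairwise_mergeSort' (· ≤ ·) l,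
        by simpa using List.pairwise_mergeSort' (· ≤ ·) r, fun x hx y hy => ?_⟩
      exact (hlr x (hl.mem_iff.1 hx) y (hr.mem_iff.1 hy)).le
    · exact List.pairwise_le_range
  have hn : n = l.length + r.length := by simpa using h.length_eq.symm
  rw [hn, List.range_add] at hs
  obtain ⟨h1, h2⟩ := List.append_inj hs (by simp)
  exact ⟨h1 ▸ hl.symm, h2 ▸ hr.symm⟩

theorem exists_word_eq {n : ℕ} {w : List ℕ} (hp : w.Perm (List.range n)) (ha : ListAvoids w) :
    ∃ T, word T = w := by
  induction n using Nat.strong_induction_on generalizing w with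
  | _ n ih =>
  cases n with
  | zero => exact ⟨nil, by simp at hp; simp [hp, word]⟩
  | succ n =>
    obtain ⟨l, r, rfl⟩ := List.append_of_mem (hp.mem_iff.2 (List.self_mem_range_succ (n := n)))
    have hp' : (l ++ r).Perm (List.range n) := by
      rw [List.range_succ] at hp
      exact (List.perm_middle.symm.trans (hp.trans (List.perm_append_singleton _ _))).cons_inv
    have hlt : ∀ x ∈ l ++ r, x < n := fun x hx => by simpa using hp'.mem_iff.1 hx
    have hnd : (l ++ r).Nodup := hp'.nodup_iff.2 List.nodup_range
    have hlr : ∀ x ∈ l, ∀ y ∈ r, x < y := by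
      intro x hx y hy
      by_contra hxy
      have hne : x ≠ y := (List.nodup_append.1 hnd).2.2 x hx y hy
      refine ha x n y ?_ ⟨by omega, hlt x (by simp [hx])⟩
      exact (List.singleton_sublist.2 hx).append ((List.singleton_sublist.2 hy).cons_cons n)
    have hn : n = l.length + r.length := by simpa using hp'.length_eq.symm
    obtain ⟨h1, h2⟩ := left_perm_range hp' hlr
    obtain ⟨r', hr', rfl⟩ : ∃ r' : List ℕ, r'.Perm (List.range r.length) ∧
        r'.map (l.length + ·) = r := by
      refine ⟨r.map (· - l.length), ?_, ?_⟩
      · simpa [Function.comp_def] using h2.map (· - l.length)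
      · rw [List.map_map]
        refine (List.map_congr_left fun x hx => ?_).trans (List.map_id r)
        have := h2.mem_iff.1 hx
        simp only [List.mem_map] at this
        simp only [Function.comp_apply, id]
        omega
    rw [List.length_map] at hr' hn
    obtain ⟨L, rfl⟩ := ih l.length (by omega) h1 (ha.of_sublist (List.sublist_append_left _ _))
    obtain ⟨R, rfl⟩ := ih r'.length (by omega) hr' (listAvoids_map_add.1
      (ha.of_sublist ((List.sublist_cons_self _ _).trans (List.sublist_append_right _ _))))
    refine ⟨node () L R, ?_⟩
    rw [word, hn]
    simp only [length_word]

theorem card_descents_eq_listDes {n : ℕ} (f : Fin n → ℕ) :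
    Nat.card {i : Fin n // ∃ h : (i : ℕ) + 1 < n, f ⟨(i : ℕ) + 1, h⟩ < f i} =
      listDes (List.ofFn f) := by
  classical
  rw [Nat.card_eq_fintype_card, Fintype.card_subtype, Finset.card_filter]
  match n with
  | 0 => simp [listDes]
  | 1 =>
    rw [List.ofFn_succ, List.ofFn_zero, listDes]
    exact Finset.sum_eq_zero fun i _ => if_neg (by rintro ⟨h, -⟩; omega)
  | n + 2 =>
    have ih := card_descents_eq_listDes (fun i : Fin (n + 1) => f i.succ)
    rw [Nat.card_eq_fintype_card, Fintype.card_subtype, Finset.card_filter] at ih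
    rw [List.ofFn_succ, List.ofFn_succ, listDes, ← List.ofFn_succ (f := fun i => f i.succ), ← ih,
      Fin.sum_univ_succ]
    congr 1
    · exact if_congr (by simp) rfl rfl
    · refine Finset.sum_congr rfl fun i _ => ?_
      simp [Fin.succ]

theorem dropLE_ofFn {n k s : ℕ} {f : Fin n → ℕ} :
    DropLE k s (List.ofFn f) ↔ ∀ i : Fin n, s + i ≤ f i + k := by
  induction n generalizing s with
  | zero => simp [DropLE]
  | succ n ih =>
    rw [List.ofFn_succ, DropLE, ih, Fin.forall_fin_succ]
    simp [add_assoc, add_comm 1]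

/-- The one-line notation of a permutation. -/
def permWord {n : ℕ} (σ : Equiv.Perm (Fin n)) : List ℕ := List.ofFn fun i => (σ i : ℕ)

theorem permWord_injective {n : ℕ} : Function.Injective (permWord (n := n)) := by
  intro σ τ h
  have := List.ofFn_injective h
  ext i
  exact congrFun this i

theorem permWord_perm {n : ℕ} (σ : Equiv.Perm (Fin n)) : (permWord σ).Perm (List.range n) := by
  rw [List.perm_ext_iff_of_nodup ?_ List.nodup_range]
  · intro x
    simp only [permWord, List.mem_ofFn, List.mem_range]
    exact ⟨fun ⟨i, hi⟩ => hi ▸ (σ i).2, fun h => ⟨σ.symm ⟨x, h⟩, by simp⟩⟩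
  · exact List.nodup_ofFn.2 (Fin.val_injective.comp σ.injective)

theorem exists_permWord_eq {n : ℕ} {w : List ℕ} (hp : w.Perm (List.range n)) :
    ∃ σ : Equiv.Perm (Fin n), permWord σ = w := by
  obtain rfl : w.length = n := by simpa using hp.length_eq
  have hnd : w.Nodup := hp.nodup_iff.2 List.nodup_range
  let f : Fin w.length → Fin w.length := fun i =>
    ⟨w[i], List.mem_range.1 (hp.mem_iff.1 (List.getElem_mem i.2))⟩
  have hf : Function.Injective f := by
    intro i j h
    exact Fin.ext ((hnd.getElem_inj_iff).1 (congrArg Fin.val h))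
  refine ⟨Equiv.ofBijective f (Finite.injective_iff_bijective.1 hf), ?_⟩
  simp only [permWord, Equiv.ofBijective_apply, f]
  exact List.ofFn_getElem

theorem listAvoids_permWord {n : ℕ} {σ : Equiv.Perm (Fin n)} :
    ListAvoids (permWord σ) ↔ avoids231 σ := by
  have hw : permWord σ = (List.finRange n).map fun i => (σ i : ℕ) := List.ofFn_eq_map
  rw [hw]
  constructor
  · rintro h ⟨i, j, k, hij, hjk, h1, h2⟩
    have hs : [i, j, k].Pairwise (· < ·) := by simp [hij, hjk, hij.trans hjk]
    have hsub : [i, j, k].Sublist (List.finRange n) :=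
      List.sublist_of_subperm_of_pairwise
        (List.subperm_of_subset (hs.imp ne_of_lt) fun x _ => List.mem_finRange x) hs
        (List.pairwise_lt_finRange n)
    exact h _ _ _ (hsub.map fun i => (σ i : ℕ)) ⟨h1, h2⟩
  · rintro h x y z hs ⟨h1, h2⟩
    obtain ⟨l, hl, e⟩ := List.sublist_map_iff.1 hs
    match l, e with
    | [i, j, k], e =>
      simp only [List.map_cons, List.map_nil, List.cons.injEq] at e
      obtain ⟨rfl, rfl, rfl, -⟩ := e
      have hlt := (List.pairwise_lt_finRange n).sublist hl
      simp only [List.pairwise_cons, List.mem_cons] at hlt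
      exact h ⟨i, j, k, hlt.1 _ (by simp), hlt.2.1 _ (by simp), h1, h2⟩

theorem des_eq_listDes {n : ℕ} (σ : Equiv.Perm (Fin n)) : des σ = listDes (permWord σ) :=
  card_descents_eq_listDes fun i => (σ i : ℕ)

theorem maxDrop_le_iff {n k : ℕ} {σ : Equiv.Perm (Fin n)} :
    maxDrop σ ≤ k ↔ DropLE k 0 (permWord σ) := by
  rw [permWord, dropLE_ofFn, maxDrop, Finset.sup_le_iff]
  simp [add_comm]

theorem a_eq_card_trees (n j k : ℕ) :
    a n j k = ((treesOfNumNodesEq n).filter fun T => treeDes T = j ∧ treeDrop T ≤ k).card := by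
  rw [a, ← Set.ncard_coe_finset, ← Set.ncard_image_of_injective _ word_injective,
    ← Set.coe_ofPred, Nat.card_coe_set_eq, ← Set.ncard_image_of_injective _ permWord_injective]
  congr 1
  ext w
  simp only [Set.mem_image, Set.mem_ofPred_eq, Finset.coe_filter, mem_treesOfNumNodesEq]
  constructor
  · rintro ⟨σ, ⟨h1, h2, h3⟩, rfl⟩
    obtain ⟨T, hT⟩ := exists_word_eq (permWord_perm σ) (listAvoids_permWord.2 h1)
    refine ⟨T, ⟨?_, ?_, ?_⟩, hT⟩
    · rw [← length_word, hT, permWord, List.length_ofFn]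
    · rw [← listDes_word, hT, ← des_eq_listDes, h2]
    · rw [← dropLE_word, hT, ← maxDrop_le_iff]; exact h3
  · rintro ⟨T, ⟨rfl, h2, h3⟩, rfl⟩
    obtain ⟨σ, hσ⟩ := exists_permWord_eq (word_perm T)
    refine ⟨σ, ⟨?_, ?_, ?_⟩, hσ⟩
    · rw [← listAvoids_permWord, hσ]; exact word_listAvoids T
    · rw [des_eq_listDes, hσ, listDes_word, h2]
    · rw [maxDrop_le_iff, hσ, dropLE_word]; exact h3

open PowerSeries Finset

/-- The generating function of binary trees, counted by number of nodes, with weights `w`. -/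
noncomputable def treeGF {R : Type*} [CommRing R] (w : BinaryTree Unit → R) : R⟦X⟧ :=
  PowerSeries.mk fun n => ∑ T ∈ treesOfNumNodesEq n, w T

theorem sum_trees_succ {R : Type*} [CommRing R] (w : BinaryTree Unit → R) (n : ℕ) :
    ∑ T ∈ treesOfNumNodesEq (n + 1), w T =
      ∑ p ∈ antidiagonal n, ∑ l ∈ treesOfNumNodesEq p.1, ∑ r ∈ treesOfNumNodesEq p.2,
        w (node () l r) := by
  rw [treesOfNumNodesEq_succ, sum_biUnion]
  · refine sum_congr rfl fun p _ => ?_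
    rw [sum_map, sum_product]
    rfl
  · simp_rw [Set.PairwiseDisjoint, Set.Pairwise, disjoint_left]
    aesop

theorem treeGF_eq_of_node {R : Type*} [CommRing R] {w u : BinaryTree Unit → R}
    (h0 : w nil = 1) (h : ∀ l r, w (node () l r) = w l * u r) :
    treeGF w = 1 + X * (treeGF w * treeGF u) := by
  ext n
  cases n with
  | zero => simp [treeGF, h0]
  | succ n =>
    rw [map_add, coeff_succ_X_mul, coeff_mul, coeff_one, if_neg (Nat.succ_ne_zero n), zero_add]
    simp only [treeGF, coeff_mk]
    rw [sum_trees_succ]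
    refine sum_congr rfl fun p _ => ?_
    rw [sum_mul_sum]
    simp only [h]

theorem treeGF_ite_nil {R : Type*} [CommRing R] (v : BinaryTree Unit → R) (h0 : v nil = 1)
    (c : R) :
    treeGF (fun T => if T = nil then 1 else c * v T) = 1 + C c * (treeGF v - 1) := by
  ext n
  cases n with
  | zero => simp [treeGF, h0]
  | succ n =>
    simp only [treeGF, coeff_mk, map_add, coeff_C_mul, map_sub, coeff_one, Nat.succ_ne_zero,
      if_false, sub_zero, zero_add]
    rw [mul_sum]
    refine sum_congr rfl fun T hT => if_neg ?_
    rintro rfl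
    simp [numNodes] at hT

/-- The weight marking descents, over trees of maximum drop at most `k`. -/
noncomputable def dropWeight (k : ℕ) (T : BinaryTree Unit) : Polynomial ℚ :=
  if treeDrop T ≤ k then Polynomial.X ^ treeDes T else 0

/-- The generating function of 231-avoiding permutations of maximum drop at most `k`, by size and
number of descents. -/
noncomputable def dropGF (k : ℕ) : (Polynomial ℚ)⟦X⟧ := treeGF (dropWeight k)

/-- The generating function of all 231-avoiding permutations by size and number of descents. -/
noncomputable def desGF : (Polynomial ℚ)⟦X⟧ := treeGF fun T => Polynomial.X ^ treeDes T

theorem dropGF_zero : dropGF 0 = 1 + X * dropGF 0 := by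
  have h1 : treeGF (fun T => if T = nil then 1 else (0 : Polynomial ℚ) * 1) = 1 := by
    rw [treeGF_ite_nil (fun _ => 1) rfl, map_zero, zero_mul, add_zero]
  have := treeGF_eq_of_node (w := dropWeight 0)
    (u := fun T => if T = nil then 1 else (0 : Polynomial ℚ) * 1)
    (by simp [dropWeight, treeDrop, treeDes]) (fun l r => by
      by_cases hr : r = nil
      · simp [dropWeight, treeDrop, treeDes, hr]
      · simp [dropWeight, treeDrop, hr])
  rwa [h1, mul_one] at this

theorem dropGF_succ (k : ℕ) :
    dropGF (k + 1) =
      1 + X * (dropGF (k + 1) * (1 + C Polynomial.X * (dropGF k - 1))) := by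
  rw [dropGF, dropGF, ← treeGF_ite_nil _ (by simp [dropWeight, treeDrop, treeDes])]
  refine treeGF_eq_of_node (by simp [dropWeight, treeDrop, treeDes]) fun l r => ?_
  by_cases hr : r = nil
  · simp [dropWeight, treeDrop, treeDes, hr]
  · simp only [dropWeight, treeDrop, treeDes, hr, if_false, max_le_iff, Nat.succ_le_succ_iff]
    by_cases h1 : treeDrop l ≤ k + 1 <;> by_cases h2 : treeDrop r ≤ k <;> simp [h1, h2]
    ring

theorem desGF_eq : desGF = 1 + X * (desGF * (1 + C Polynomial.X * (desGF - 1))) := by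
  rw [desGF, ← treeGF_ite_nil _ (by simp [treeDes])]
  refine treeGF_eq_of_node (by simp [treeDes]) fun l r => ?_
  by_cases hr : r = nil
  · simp [treeDes, hr]
  · simp only [treeDes, hr, if_false]
    ring

theorem coeff_coeff_dropGF (n j k : ℕ) : (coeff n (dropGF k)).coeff j = a n j k := by
  rw [dropGF, treeGF, coeff_mk, Polynomial.finsetSum_coeff, a_eq_card_trees, card_filter,
    Nat.cast_sum]
  refine sum_congr rfl fun T _ => ?_
  simp only [dropWeight]
  split_ifs with h1 h2 h2 <;> simp_all [Polynomial.coeff_X_pow, eq_comm]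

section Truncation

variable {R : Type*} [CommRing R] {x t u N : R}

theorem exists_eq_add_mul {A B : R} (hu : u * (1 - x) = 1)
    (h : A = 1 + x * (A * (1 + t * (B - 1)))) : ∃ G, A = u + t * G :=
  ⟨u * x * (A * (B - 1)), by linear_combination u * h - A * hu⟩

theorem exists_eq_add_sq_mul {A B H : R} (hu : u * (1 - x) = 1)
    (h : A = 1 + x * (A * (1 + t * (B - 1)))) (hB : B = u + t * H) :
    ∃ K, A = u + t * (x ^ 2 * u ^ 3) + t ^ 2 * K := by
  obtain ⟨G, hG⟩ := exists_eq_add_mul hu h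
  refine ⟨u * x * (G * (B - 1) + u * H), ?_⟩
  linear_combination u * h - A * hu + u * x * t * ((B - 1) * hG + u * hB + u * hu)

theorem exists_sub_eq {A : ℕ → R} (hu : u * (1 - x) = 1) (h0 : A 0 = 1 + x * A 0)
    (hs : ∀ k, A (k + 1) = 1 + x * (A (k + 1) * (1 + t * (A k - 1))))
    (hN : N = 1 + x * (N * (1 + t * (N - 1)))) (k : ℕ) :
    ∃ G, N - A k = t ^ (k + 1) * (x ^ (k + 2) * u ^ (2 * k + 3)) +
      t ^ (k + 2) * ((2 * k + 1) * (x ^ (k + 4) * u ^ (2 * k + 5)) +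
        x ^ (k + 3) * u ^ (2 * k + 5)) + t ^ (k + 3) * G := by
  have hA0 : A 0 = u := by linear_combination u * h0 - A 0 * hu
  obtain ⟨G, hG⟩ := exists_eq_add_mul hu hN
  obtain ⟨K, hK⟩ := exists_eq_add_sq_mul hu hN hG
  induction k with
  | zero =>
    have h1 : N - 1 = x * u + t * (x ^ 2 * u ^ 3) + t ^ 2 * K := by linear_combination hK + hu
    have h2 : N - A 0 = u * x * t * (N * (N - 1)) := by
      linear_combination u * hN - N * hu - hA0
    refine ⟨u * x * ((x ^ 2 * u ^ 3) ^ 2 + K * (u + x * u) + 2 * t * (x ^ 2 * u ^ 3) * K +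
      t ^ 2 * K ^ 2), ?_⟩
    rw [h2, h1, hK]
    push_cast
    ring
  | succ k ih =>
    obtain ⟨E, hE⟩ := ih
    obtain ⟨H, hH⟩ : ∃ H, A k = u + t * H := by
      cases k with
      | zero => exact ⟨0, by rw [hA0, mul_zero, add_zero]⟩
      | succ k => exact exists_eq_add_mul hu (hs k)
    obtain ⟨L, hL⟩ := exists_eq_add_sq_mul hu (hs k) hH
    have h1 : N - A (k + 1) = x * t * (N * A (k + 1) * (N - A k)) := by
      linear_combination A (k + 1) * hN - N * hs k
    have h2 : N * A (k + 1) = u ^ 2 + t * (2 * x ^ 2 * u ^ 4) +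
        t ^ 2 * (u * (K + L) + (x ^ 2 * u ^ 3 + t * K) * (x ^ 2 * u ^ 3 + t * L)) := by
      rw [hL, hK]; ring
    generalize u * (K + L) + (x ^ 2 * u ^ 3 + t * K) * (x ^ 2 * u ^ 3 + t * L) = M at h2
    refine ⟨x * (u ^ 2 * E + 2 * x ^ 2 * u ^ 4 * ((2 * k + 1) * (x ^ (k + 4) * u ^ (2 * k + 5)) +
        x ^ (k + 3) * u ^ (2 * k + 5) + t * E) + M * (x ^ (k + 2) * u ^ (2 * k + 3) +
        t * ((2 * k + 1) * (x ^ (k + 4) * u ^ (2 * k + 5)) +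
        x ^ (k + 3) * u ^ (2 * k + 5)) + t ^ 2 * E)), ?_⟩
    rw [h1, h2, hE]
    push_cast
    ring

end Truncation

theorem coeff_X_pow_mul_geom_pow {R : Type*} [CommRing R] (n m d : ℕ) (hd : 0 < d) :
    coeff n (X ^ m * (PowerSeries.mk 1 : R⟦X⟧) ^ (d + 1)) = ((n + d - m).choose d : R) := by
  rw [coeff_X_pow_mul', mk_one_pow_eq_mk_choose_add, coeff_mk]
  split_ifs with h
  · rw [show n + d - m = d + (n - m) by omega]
  · rw [Nat.choose_eq_zero_of_lt (by omega), Nat.cast_zero]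

theorem coeff_coeff_desGF_sub (n k : ℕ) :
    (coeff n (desGF - dropGF k)).coeff (k + 2) =
      (2 * k + 1) * ((n + k).choose (2 * k + 4) : ℚ) + (n + k + 1).choose (2 * k + 4) := by
  obtain ⟨G, hG⟩ := exists_sub_eq (mk_one_mul_one_sub_eq_one (Polynomial ℚ)) dropGF_zero
    dropGF_succ desGF_eq k
  have h2k : (2 * k + 1 : (Polynomial ℚ)⟦X⟧) = C (2 * k + 1 : Polynomial ℚ) := by
    simp only [map_add, map_mul, map_one, map_natCast, map_ofNat]
  rw [hG, h2k]
  simp only [← map_pow, LinearMap.map_add, coeff_C_mul]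
  rw [show 2 * k + 3 = (2 * k + 2) + 1 by ring, show 2 * k + 5 = (2 * k + 4) + 1 by ring,
    coeff_X_pow_mul_geom_pow _ _ _ (by omega), coeff_X_pow_mul_geom_pow _ _ _ (by omega),
    coeff_X_pow_mul_geom_pow _ _ _ (by omega), show n + (2 * k + 4) - (k + 4) = n + k by omega,
    show n + (2 * k + 4) - (k + 3) = n + k + 1 by omega]
  have h1 (a b : ℕ) :
      (2 * k + 1 : Polynomial ℚ) * a + b = Polynomial.C ((2 * k + 1) * a + b : ℚ) := by
    simp only [map_add, map_mul, map_one, map_natCast, map_ofNat]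
  rw [h1, ← Polynomial.C_eq_natCast]
  simp [Polynomial.coeff_X_pow_mul', Polynomial.coeff_C]

theorem desGF_rec (m : ℕ) :
    Polynomial.C (m + 3 : ℚ) * coeff (m + 2) desGF =
      Polynomial.C (2 * m + 3 : ℚ) * (coeff (m + 1) desGF + Polynomial.X * coeff (m + 1) desGF) -
      (Polynomial.C (m : ℚ) * coeff m desGF -
        Polynomial.X * (Polynomial.C (2 : ℚ) * (Polynomial.C (m : ℚ) * coeff m desGF)) +
        Polynomial.X * (Polynomial.X * (Polynomial.C (m : ℚ) * coeff m desGF))) := by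
  set t : Polynomial ℚ := Polynomial.X with ht
  set S : (Polynomial ℚ)⟦X⟧ := C (2 * t) * (X * desGF) + C (1 - t) * X - 1 with hS
  have hSS : S * S = 1 - C (2 * (1 + t)) * X + C ((1 - t) ^ 2) * (X * X) := by
    have := desGF_eq
    simp only [hS, map_mul, map_add, map_sub, map_one, map_pow, map_ofNat]
    linear_combination (-4) * C t * X * this
  have hD : C 2 * (S * derivative _ S) = C 2 * (C ((1 - t) ^ 2) * X - C (1 + t)) := by
    have := congrArg (derivative (Polynomial ℚ)) hSS
    simp only [Derivation.leibniz, map_add, map_sub, derivative_C, derivative_X, smul_eq_mul,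
      mul_zero, add_zero, mul_one, Derivation.map_one_eq_zero] at this
    simp only [map_mul, map_add, map_sub, map_one, map_pow, map_ofNat] at this ⊢
    linear_combination this
  have h2 : (C 2 : (Polynomial ℚ)⟦X⟧) ≠ 0 := by
    rw [Ne, map_eq_zero_iff _ C_injective]; exact two_ne_zero
  have hD' := mul_left_cancel₀ h2 hD
  have hode : derivative _ S - C (2 * (1 + t)) * (X * derivative _ S) +
      C ((1 - t) ^ 2) * (X * (X * derivative _ S)) =
      C ((1 - t) ^ 2) * (X * S) - C (1 + t) * S := by
    linear_combination S * hD' - derivative _ S * hSS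
  have hc := congrArg (coeff (m + 2)) hode
  simp only [LinearMap.map_add, LinearMap.map_sub, coeff_C_mul, coeff_succ_X_mul,
    coeff_derivative] at hc
  have h3 (i : ℕ) : coeff (i + 2) S = 2 * t * coeff (i + 1) desGF := by
    rw [hS, LinearMap.map_sub, LinearMap.map_add, coeff_C_mul, coeff_C_mul, coeff_succ_X_mul,
      coeff_X, coeff_one]
    simp
  have h4 : (m : Polynomial ℚ) * coeff (m + 1) S = 2 * t * (m * coeff m desGF) := by
    cases m with
    | zero => simp
    | succ m => rw [h3]; ring
  rw [show m + 2 + 1 = m + 1 + 2 from rfl, show m + 1 + 1 = m + 2 from rfl, h3, h3] at hc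
  have ht0 : (2 * t : Polynomial ℚ) ≠ 0 := mul_ne_zero two_ne_zero Polynomial.X_ne_zero
  apply mul_left_cancel₀ ht0
  simp only [map_add, map_mul, map_natCast, map_ofNat]
  push_cast at hc
  linear_combination hc - (1 - t) ^ 2 * h4

theorem succ_mul_choose_succ (m k : ℕ) :
    ((k : ℚ) + 1) * m.choose (k + 1) = (m - k) * m.choose k := by
  rcases le_or_gt k m with h | h
  · have := Nat.choose_succ_right_eq m k
    rw [← Nat.cast_sub h]
    exact_mod_cast (by linarith : (k + 1) * m.choose (k + 1) = (m - k) * m.choose k)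
  · simp [Nat.choose_eq_zero_of_lt h, Nat.choose_eq_zero_of_lt (h.trans (Nat.lt_succ_self k))]

theorem narayana_identity {m j a b c d : ℚ} (hb : (j + 1) * b = (m - j) * a)
    (hc : (j + 2) * c = (m - j - 1) * b) (hd : (j + 3) * d = (m - j - 2) * c)
    (h2 : j + 2 ≠ 0) (h3 : j + 3 ≠ 0) (h1 : j + 1 ≠ 0 ) :
    (m + 3) * (m + 1) * ((a + 2 * b + c) * (b + 2 * c + d)) =
      (2 * m + 3) * (m + 2) * ((b + c) * (c + d) + (a + b) * (b + c)) -
        (m + 1) * (m + 2) * (c * d - 2 * (b * c) + a * b) := by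
  obtain rfl : b = (m - j) * a / (j + 1) := by field_simp; linear_combination hb
  obtain rfl : c = (m - j - 1) * ((m - j) * a / (j + 1)) / (j + 2) := by
    rw [eq_div_iff h2]; linear_combination hc
  obtain rfl : d = (m - j - 2) * ((m - j - 1) * ((m - j) * a / (j + 1)) / (j + 2)) / (j + 3) := by
    rw [eq_div_iff h3]; linear_combination hd
  field_simp
  ring

theorem mul_coeff_coeff_desGF (n j : ℕ) :
    (n : ℚ) * (coeff n desGF).coeff j = n.choose j * n.choose (j + 1) := by
  induction n using Nat.twoStepInduction generalizing j with
  | zero => simp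
  | one =>
    have h0 : constantCoeff desGF = 1 := by
      rw [desGF_eq]; simp
    have h1 : coeff 1 desGF = 1 := by
      rw [desGF_eq, map_add, show 1 = 0 + 1 from rfl, coeff_succ_X_mul]
      simp [h0, coeff_one]
    rw [h1]
    rcases j with _ | j
    · simp
    · simp [Polynomial.coeff_one, Nat.choose_eq_zero_of_lt (show 1 < j + 1 + 1 by omega)]
  | more m ih0 ih1 =>
    have hrec := congrArg (Polynomial.coeff · j) (desGF_rec m)
    have hm1 : (m + 1 : ℚ) ≠ 0 := by positivity
    have hm3 : (m + 3 : ℚ) ≠ 0 := by positivity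
    apply mul_left_cancel₀ (mul_ne_zero hm3 hm1)
    push_cast at ih1 ⊢
    match j with
    | 0 =>
      simp only [Polynomial.coeff_sub, Polynomial.coeff_add, Polynomial.coeff_C_mul,
        Polynomial.coeff_X_mul_zero] at hrec
      have e0 := ih0 0
      have e1 := ih1 0
      simp only [Nat.choose_zero_right, zero_add, Nat.choose_one_right, Nat.cast_one] at e0 e1 ⊢
      push_cast at e1 ⊢
      linear_combination (m + 1) * (m + 2) * hrec + (2 * m + 3) * (m + 2) * e1 -
        (m + 1) * (m + 2) * e0
    | 1 =>
      simp only [Polynomial.coeff_sub, Polynomial.coeff_add, Polynomial.coeff_C_mul,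
        Polynomial.coeff_X_mul_zero, Polynomial.coeff_X_mul] at hrec
      have e0 := ih0 0
      have e1 := ih0 1
      have e2 := ih1 0
      have e3 := ih1 1
      simp only [Nat.choose_zero_right, zero_add, Nat.choose_one_right, Nat.cast_one, Nat.reduceAdd,
        Nat.cast_choose_two] at e0 e1 e2 e3 ⊢
      push_cast at e2 e3 ⊢
      linear_combination (m + 1) * (m + 2) * hrec + (2 * m + 3) * (m + 2) * (e2 + e3) -
        (m + 1) * (m + 2) * (e1 - 2 * e0)
    | j + 2 =>
      simp only [Polynomial.coeff_sub, Polynomial.coeff_add, Polynomial.coeff_C_mul,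
        Polynomial.coeff_X_mul] at hrec
      have hid := narayana_identity (c := m.choose (j + 2)) (d := m.choose (j + 3))
        (succ_mul_choose_succ m j)
        (by have := succ_mul_choose_succ m (j + 1); push_cast at this; linear_combination this)
        (by have := succ_mul_choose_succ m (j + 2); push_cast at this; linear_combination this)
        (by positivity) (by positivity) (by positivity)
      have e0 := ih0 j
      have e1 := ih0 (j + 1)
      have e2 := ih0 (j + 2)
      have e3 := ih1 (j + 1)
      have e4 := ih1 (j + 2)
      simp only [Nat.choose_succ_succ', Nat.cast_add] at e0 e1 e2 e3 e4 ⊢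
      linear_combination (m + 1) * (m + 2) * hrec + (2 * m + 3) * (m + 2) * (e3 + e4) -
        (m + 1) * (m + 2) * (e2 - 2 * e1 + e0) - hid

end Perm231

theorem a_j_minus_two (n j : ℕ) (hj : 2 ≤ j) (hn : 1 ≤ n) :
    (n : ℤ) * a n j (j - 2) =
      (n.choose j : ℤ) * n.choose (j + 1) - (n : ℤ) * (n + j - 1).choose (2 * j) -
        (n : ℤ) * (2 * j - 3) * (n + j - 2).choose (2 * j) := by
  obtain ⟨k, rfl⟩ := Nat.exists_eq_add_of_le' hj
  have h1 := Perm231.mul_coeff_coeff_desGF n (k + 2)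
  have h2 := Perm231.coeff_coeff_desGF_sub n k
  rw [map_sub, Polynomial.coeff_sub, Perm231.coeff_coeff_dropGF] at h2
  rw [Nat.add_sub_cancel, show n + (k + 2) - 1 = n + k + 1 by omega,
    show n + (k + 2) - 2 = n + k by omega, show 2 * (k + 2) = 2 * k + 4 by ring]
  suffices h : (n : ℚ) * a n (k + 2) k =
      (n.choose (k + 2) : ℚ) * n.choose (k + 2 + 1) - (n : ℚ) * (n + k + 1).choose (2 * k + 4) -
        (n : ℚ) * (2 * (k + 2 : ℕ) - 3) * (n + k).choose (2 * k + 4) by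
    exact_mod_cast h
  push_cast
  linear_combination h1 - n * h2
end

section
/- Let D(n, j, k) denote the number of Dyck paths of length 2n with exactly j peaks and height at most k, with the convention D(0, 0, k) = 1. Then for all k ≥ 1 and all n ≥ j ≥ 1, D(n, j, k) = Σ_{i=0}^{n−j} D(n−j, i, k−1) · C(2n−j−i, 2n−2j). -/
/-- `s` encodes a Dyck path of length `2n`: steps `s 0, …, s (2n-1)` are `±1`,
all partial sums are nonnegative, the total sum is `0`, and `s` is `0` beyond `2n`. -/
def IsDyckPath (n : ℕ) (s : ℕ → ℤ) : Prop :=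
  (∀ i < 2 * n, s i = 1 ∨ s i = -1) ∧ (∀ i, 2 * n ≤ i → s i = 0) ∧
    (∀ m ≤ 2 * n, 0 ≤ ∑ i ∈ Finset.range m, s i) ∧ ∑ i ∈ Finset.range (2 * n), s i = 0

/-- The number of peaks of a Dyck path: positions where an up-step is
immediately followed by a down-step. -/
noncomputable def numPeaks (n : ℕ) (s : ℕ → ℤ) : ℕ :=
  Nat.card {i : ℕ // i + 1 < 2 * n ∧ s i = 1 ∧ s (i + 1) = -1}

/-- The height of a Dyck path: the maximum partial sum. -/
def pathHeight (n : ℕ) (s : ℕ → ℤ) : ℕ :=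
  (Finset.range (2 * n + 1)).sup fun m => (∑ i ∈ Finset.range m, s i).toNat

/-- The number of Dyck paths of length `2n` with exactly `j` peaks and height at most `k`. -/
noncomputable def dyckCount (n j k : ℕ) : ℕ :=
  Nat.card {s : ℕ → ℤ // IsDyckPath n s ∧ numPeaks n s = j ∧ pathHeight n s ≤ k}

namespace DyckWordCount

/-- Delete all factors `true, false` of a word, in a single pass. -/
def removePeaks : List Bool → List Bool
  | [] => []
  | false :: w => false :: removePeaks w
  | [true] => [true]
  | true :: true :: w => true :: removePeaks (true :: w)
  | true :: false :: w => removePeaks w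

/-- The number of factors `true, false` of a word. -/
def peaks : List Bool → ℕ
  | [] => 0
  | false :: w => peaks w
  | [true] => 0
  | true :: true :: w => peaks (true :: w)
  | true :: false :: w => peaks w + 1

/-- The step encoded by a letter. -/
def step (b : Bool) : ℤ := if b then 1 else -1

/-- The sequence of steps encoded by a word, continued by `0`. -/
def steps : List Bool → ℕ → ℤ
  | [], _ => 0
  | b :: _, 0 => step b
  | _ :: w, i + 1 => steps w i

/-- The path encoded by a word, started at height `h`, stays in `[0, k]` and ends at `0`. -/
def StaysIn (k : ℤ) : ℤ → List Bool → Prop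
  | h, [] => h = 0 ∧ h ≤ k
  | h, b :: w => 0 ≤ h ∧ h ≤ k ∧ StaysIn k (h + step b) w

theorem StaysIn.bounds {k h : ℤ} {w : List Bool} (hw : StaysIn k h w) : 0 ≤ h ∧ h ≤ k := by
  cases w with
  | nil => exact ⟨hw.1.ge, hw.2⟩
  | cons b w => exact ⟨hw.1, hw.2.1⟩

theorem staysIn_removePeaks_iff {k : ℤ} (w : List Bool) :
    ∀ {h : ℤ}, h ≤ k → (StaysIn k h (removePeaks w) ↔ StaysIn (k + 1) h w) := by
  induction w using removePeaks.induct with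
  | case1 => intro h hk; simp only [removePeaks, StaysIn]; omega
  | case2 w ih =>
    intro h hk
    have := ih (h := h + step false) (by simp [step]; omega)
    simp only [removePeaks, StaysIn, this]
    grind
  | case3 => intro h hk; simp only [removePeaks, StaysIn, step]; simp; omega
  | case4 w ih =>
    intro h hk
    simp only [removePeaks]
    by_cases hlt : h + 1 ≤ k
    · have := ih (h := h + step true) (by simpa [step] using hlt)
      rw [StaysIn, this, StaysIn.eq_2 (k + 1) h]
      grind
    · constructor
      · intro hw
        have := hw.2.2.bounds
        simp [step] at this
        omega
      · intro hw
        have := hw.2.2.2.2.bounds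
        simp [step] at this
        omega
  | case5 w ih =>
    intro h hk
    have hs : h + step true + step false = h := by simp [step]
    simp only [removePeaks, StaysIn, hs, ih hk]
    constructor
    · intro hw
      have := hw.bounds
      simp only [step]
      simp
      exact ⟨by omega, by omega, by omega, by omega, hw⟩
    · intro hw
      exact hw.2.2.2.2

theorem two_mul_peaks_le_length (w : List Bool) : 2 * peaks w ≤ w.length := by
  induction w using removePeaks.induct <;> simp_all [peaks] <;> omega

theorem length_removePeaks (w : List Bool) :
    (removePeaks w).length + 2 * peaks w = w.length := by
  induction w using removePeaks.induct <;> simp_all [peaks, removePeaks] <;> omega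

/-- The words with `j` peaks whose peak removal is `v`. -/
def insertions (v : List Bool) (j : ℕ) : Set (List Bool) :=
  {w | removePeaks w = v ∧ peaks w = j}

theorem insertions_nil_zero : insertions [] 0 = {[]} := by
  ext w
  rcases w with _ | ⟨_ | _, _ | ⟨_ | _, w⟩⟩ <;> simp [insertions, removePeaks, peaks]

theorem insertions_nil_succ (j : ℕ) :
    insertions [] (j + 1) = (fun w => true :: false :: w) '' insertions [] j := by
  ext w
  rcases w with _ | ⟨_ | _, _ | ⟨_ | _, w⟩⟩ <;> simp [insertions, removePeaks, peaks]

theorem insertions_false_zero (v : List Bool) :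
    insertions (false :: v) 0 = (fun w => false :: w) '' insertions v 0 := by
  ext w
  rcases w with _ | ⟨_ | _, _ | ⟨_ | _, w⟩⟩ <;> simp [insertions, removePeaks, peaks]

theorem insertions_false_succ (v : List Bool) (j : ℕ) :
    insertions (false :: v) (j + 1) =
      (fun w => true :: false :: w) '' insertions (false :: v) j ∪
        (fun w => false :: w) '' insertions v (j + 1) := by
  ext w
  rcases w with _ | ⟨_ | _, _ | ⟨_ | _, w⟩⟩ <;> simp [insertions, removePeaks, peaks]

theorem insertions_true_false_zero (v : List Bool) : insertions (true :: false :: v) 0 = ∅ := by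
  ext w
  rcases w with _ | ⟨_ | _, _ | ⟨_ | _, _ | ⟨_ | _, w⟩⟩⟩ <;>
    simp [insertions, removePeaks, peaks]

theorem insertions_true_false_succ (v : List Bool) (j : ℕ) :
    insertions (true :: false :: v) (j + 1) =
      (fun w => true :: false :: w) '' insertions (true :: false :: v) j ∪
        (fun w => true :: true :: false :: w) '' insertions (false :: v) j := by
  ext w
  rcases w with _ | ⟨_ | _, _ | ⟨_ | _, _ | ⟨_ | _, w⟩⟩⟩ <;>
    simp [insertions, removePeaks, peaks]

theorem insertions_true_zero {v : List Bool} (hv : v.head? ≠ some false) :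
    insertions (true :: v) 0 = (fun w => true :: w) '' insertions v 0 := by
  ext w
  rcases w with _ | ⟨_ | _, _ | ⟨_ | _, w⟩⟩ <;> simp [insertions, removePeaks, peaks]
  rintro rfl
  simp at hv

theorem insertions_true_succ {v : List Bool} (hv : v.head? ≠ some false) (j : ℕ) :
    insertions (true :: v) (j + 1) =
      (fun w => true :: false :: w) '' insertions (true :: v) j ∪
        (fun w => true :: w) '' insertions v (j + 1) := by
  ext w
  rcases w with _ | ⟨_ | _, _ | ⟨_ | _, w⟩⟩ <;> simp [insertions, removePeaks, peaks]
  rintro rfl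
  simp at hv

theorem peaks_true_cons {v : List Bool} (hv : v.head? ≠ some false) :
    peaks (true :: v) = peaks v := by
  rcases v with _ | ⟨_ | _, v⟩ <;> simp_all [peaks]

theorem encard_insertions (v : List Bool) (j : ℕ) :
    (insertions v j).encard = ((v.length + j - peaks v).choose v.length : ℕ) := by
  have inj1 (b : Bool) : Function.Injective (fun w : List Bool => b :: w) := fun _ _ h => by
    simpa using h
  have inj2 : Function.Injective (fun w : List Bool => true :: false :: w) := fun _ _ h => by
    simpa using h
  have inj3 : Function.Injective (fun w : List Bool => true :: true :: false :: w) :=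
    fun _ _ h => by simpa using h
  induction v generalizing j with
  | nil =>
    induction j with
    | zero => simp [insertions_nil_zero, peaks]
    | succ j ih => rw [insertions_nil_succ, inj2.encard_image, ih]; simp
  | cons b v ih =>
    have hp := two_mul_peaks_le_length v
    cases b with
    | false =>
      induction j with
      | zero =>
        rw [insertions_false_zero, (inj1 _).encard_image, ih]
        rcases Nat.eq_zero_or_pos (peaks v) with h | h
        · simp [peaks, h]
        · rw [Nat.choose_eq_zero_of_lt (by omega),
            Nat.choose_eq_zero_of_lt (by simp [peaks]; omega)]
      | succ j ihj =>
        rw [insertions_false_succ, Set.encard_union_eq, inj2.encard_image, (inj1 _).encard_image,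
          ih, ihj, ← Nat.cast_add]
        · simp only [List.length_cons, peaks]
          rw [show v.length + 1 + (j + 1) - peaks v = (v.length + (j + 1) - peaks v) + 1 by omega,
            Nat.choose_succ_succ, add_comm,
            show v.length + 1 + j - peaks v = v.length + (j + 1) - peaks v by omega]
        · rw [Set.disjoint_left]
          rintro _ ⟨w, -, rfl⟩
          simp
    | true =>
      by_cases hv : v.head? = some false
      · obtain ⟨v, rfl⟩ : ∃ u, v = false :: u := by
          rcases v with _ | ⟨_ | _, v⟩ <;> simp_all
        simp only [List.length_cons, peaks] at *
        induction j with
        | zero =>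
          rw [insertions_true_false_zero, Nat.choose_eq_zero_of_lt (by omega)]
          simp
        | succ j ihj =>
          rw [insertions_true_false_succ, Set.encard_union_eq, inj2.encard_image,
            inj3.encard_image, ih, ihj, ← Nat.cast_add]
          · rw [show v.length + 1 + 1 + (j + 1) - (peaks v + 1)
                = (v.length + 1 + j - peaks v) + 1 by omega,
              Nat.choose_succ_succ, add_comm,
              show v.length + 1 + 1 + j - (peaks v + 1) = v.length + 1 + j - peaks v by omega]
          · rw [Set.disjoint_left]
            rintro _ ⟨w, -, rfl⟩
            simp
      · rw [peaks_true_cons hv]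
        induction j with
        | zero =>
          rw [insertions_true_zero hv, (inj1 _).encard_image, ih]
          rcases Nat.eq_zero_or_pos (peaks v) with h | h
          · simp [h]
          · rw [Nat.choose_eq_zero_of_lt (by omega),
              Nat.choose_eq_zero_of_lt (by simp; omega)]
        | succ j ihj =>
          rw [insertions_true_succ hv, Set.encard_union_eq, inj2.encard_image,
            (inj1 _).encard_image, ih, ihj, ← Nat.cast_add]
          · simp only [List.length_cons]
            rw [show v.length + 1 + (j + 1) - peaks v = (v.length + (j + 1) - peaks v) + 1
                by omega,
              Nat.choose_succ_succ, add_comm,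
              show v.length + 1 + j - peaks v = v.length + (j + 1) - peaks v by omega]
          · rw [Set.disjoint_left]
            rintro _ ⟨w, -, rfl⟩ ⟨u, ⟨hu, -⟩, h⟩
            obtain rfl : u = false :: w := by simpa using h
            exact hv (by simp [← hu, removePeaks])

theorem steps_of_length_le {w : List Bool} {i : ℕ} (hi : w.length ≤ i) : steps w i = 0 := by
  induction w generalizing i with
  | nil => rfl
  | cons b w ih =>
    cases i with
    | zero => simp at hi
    | succ i => exact ih (by simpa using hi)

theorem steps_of_lt_length {w : List Bool} {i : ℕ} (hi : i < w.length) :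
    steps w i = 1 ∨ steps w i = -1 := by
  induction w generalizing i with
  | nil => simp at hi
  | cons b w ih =>
    cases i with
    | zero => cases b <;> simp [steps, step]
    | succ i => exact ih (by simpa using hi)

theorem steps_injective : Function.Injective steps := by
  intro v w h
  induction v generalizing w with
  | nil =>
    cases w with
    | nil => rfl
    | cons b w => have := congrFun h 0; cases b <;> simp [steps, step] at this
  | cons a v ih =>
    cases w with
    | nil => have := congrFun h 0; cases a <;> simp [steps, step] at this
    | cons b w =>
      have h0 := congrFun h 0
      rw [ih (funext fun i => congrFun h (i + 1))]
      cases a <;> cases b <;> simp [steps, step] at h0 ⊢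

theorem exists_steps_eq (m : ℕ) {s : ℕ → ℤ} (h1 : ∀ i < m, s i = 1 ∨ s i = -1)
    (h0 : ∀ i, m ≤ i → s i = 0) : ∃ w : List Bool, w.length = m ∧ steps w = s := by
  induction m generalizing s with
  | zero => exact ⟨[], rfl, funext fun i => (h0 i (Nat.zero_le i)).symm⟩
  | succ m ih =>
    obtain ⟨w, hw, hs⟩ := ih (s := fun i => s (i + 1)) (fun i hi => h1 _ (by omega))
      (fun i hi => h0 _ (by omega))
    obtain ⟨b, hb⟩ : ∃ b, step b = s 0 := by
      rcases h1 0 (by omega) with h | h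
      · exact ⟨true, by simp [step, h]⟩
      · exact ⟨false, by simp [step, h]⟩
    refine ⟨b :: w, by simp [hw], funext fun i => ?_⟩
    cases i with
    | zero => exact hb
    | succ i => exact congrFun hs i

theorem staysIn_iff (k h : ℤ) (w : List Bool) :
    StaysIn k h w ↔
      (∀ m ≤ w.length, 0 ≤ h + ∑ i ∈ Finset.range m, steps w i ∧
        h + ∑ i ∈ Finset.range m, steps w i ≤ k) ∧
      h + ∑ i ∈ Finset.range w.length, steps w i = 0 := by
  induction w generalizing h with
  | nil => simp [StaysIn]; omega
  | cons b w ih =>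
    have hsum (m : ℕ) : h + ∑ i ∈ Finset.range (m + 1), steps (b :: w) i
        = h + step b + ∑ i ∈ Finset.range m, steps w i := by
      rw [Finset.sum_range_succ']
      simp only [steps]
      ring
    rw [StaysIn, ih, List.length_cons, hsum]
    constructor
    · rintro ⟨h0, hk, hm, he⟩
      refine ⟨fun m hmw => ?_, he⟩
      cases m with
      | zero => simpa using ⟨h0, hk⟩
      | succ m => rw [hsum]; exact hm m (by omega)
    · rintro ⟨hm, he⟩
      have := hm 0 (by omega)
      simp only [Finset.range_zero, Finset.sum_empty, add_zero] at this
      refine ⟨this.1, this.2, fun m hmw => ?_, he⟩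
      rw [← hsum]
      exact hm (m + 1) (by omega)

theorem encard_peak_positions (w : List Bool) :
    {i | steps w i = 1 ∧ steps w (i + 1) = -1}.encard = peaks w := by
  have shift (b : Bool) (w : List Bool) (hb : ¬ (step b = 1 ∧ steps w 0 = -1)) :
      {i | steps (b :: w) i = 1 ∧ steps (b :: w) (i + 1) = -1} =
        Nat.succ '' {i | steps w i = 1 ∧ steps w (i + 1) = -1} := by
    ext i
    cases i with
    | zero => simpa [steps] using hb
    | succ i => simp [steps]
  induction w using removePeaks.induct with
  | case1 => simp [steps, peaks]
  | case2 w ih =>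
    rw [shift _ _ (by simp [step]), Nat.succ_injective.encard_image, ih, peaks]
  | case3 => rw [shift _ _ (by simp [steps]), Nat.succ_injective.encard_image]; simp [steps, peaks]
  | case4 w ih =>
    rw [shift _ _ (by simp [steps, step]), Nat.succ_injective.encard_image, ih, peaks]
  | case5 w ih =>
    have h : {i | steps (true :: false :: w) i = 1 ∧ steps (true :: false :: w) (i + 1) = -1} =
        insert 0 (Nat.succ '' (Nat.succ '' {i | steps w i = 1 ∧ steps w (i + 1) = -1})) := by
      rw [← shift false w (by simp [step])]
      ext i
      cases i with
      | zero => simp [steps, step]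
      | succ i => simp [steps]
    rw [h, Set.encard_insert_of_notMem (by simp), Nat.succ_injective.encard_image,
      Nat.succ_injective.encard_image, ih, peaks]
    simp

theorem numPeaks_steps {n : ℕ} {w : List Bool} (hw : w.length = 2 * n) :
    numPeaks n (steps w) = peaks w := by
  have h : {i | i + 1 < 2 * n ∧ steps w i = 1 ∧ steps w (i + 1) = -1} =
      {i | steps w i = 1 ∧ steps w (i + 1) = -1} := by
    ext i
    refine ⟨fun h => h.2, fun h => ⟨?_, h⟩⟩
    by_contra hi
    have := h.2
    rw [steps_of_length_le (by omega)] at this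
    simp at this
  change Set.ncard {i | i + 1 < 2 * n ∧ steps w i = 1 ∧ steps w (i + 1) = -1} = _
  rw [h, Set.ncard, encard_peak_positions, ENat.toNat_natCast]

theorem isDyckPath_and_pathHeight_le_iff {n k : ℕ} {w : List Bool} (hw : w.length = 2 * n) :
    IsDyckPath n (steps w) ∧ pathHeight n (steps w) ≤ k ↔ StaysIn k 0 w := by
  rw [staysIn_iff, IsDyckPath, pathHeight, Finset.sup_le_iff, hw]
  simp only [zero_add, Finset.mem_range, Nat.lt_succ_iff, Int.toNat_le]
  constructor
  · rintro ⟨⟨-, -, h0, he⟩, hk⟩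
    exact ⟨fun m hm => ⟨h0 m hm, hk m hm⟩, he⟩
  · rintro ⟨h, he⟩
    exact ⟨⟨fun i hi => steps_of_lt_length (by omega), fun i hi => steps_of_length_le (by omega),
      fun m hm => (h m hm).1, he⟩, fun m hm => (h m hm).2⟩

theorem finite_staysIn (n k : ℕ) :
    {w : List Bool | w.length = 2 * n ∧ StaysIn k 0 w}.Finite :=
  (List.finite_length_eq Bool (2 * n)).subset fun _ h => h.1

/-- The words of Dyck paths of length `2n` and height at most `k`. -/
noncomputable def dyckWords (n k : ℕ) : Finset (List Bool) := (finite_staysIn n k).toFinset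

theorem mem_dyckWords {n k : ℕ} {w : List Bool} :
    w ∈ dyckWords n k ↔ w.length = 2 * n ∧ StaysIn k 0 w := by
  simp [dyckWords]

theorem dyckCount_eq_card (n j k : ℕ) :
    dyckCount n j k = {w ∈ dyckWords n k | peaks w = j}.card := by
  have h : {s | IsDyckPath n s ∧ numPeaks n s = j ∧ pathHeight n s ≤ k} =
      steps '' ({w ∈ dyckWords n k | peaks w = j} : Finset (List Bool)) := by
    ext s
    simp only [Set.mem_ofPred_eq, Set.mem_image, Finset.mem_coe, Finset.mem_filter, mem_dyckWords]
    constructor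
    · rintro ⟨hd, hp, hh⟩
      obtain ⟨w, hw, rfl⟩ := exists_steps_eq (2 * n) hd.1 hd.2.1
      exact ⟨w, ⟨⟨hw, (isDyckPath_and_pathHeight_le_iff hw).1 ⟨hd, hh⟩⟩,
        (numPeaks_steps hw).symm.trans hp⟩, rfl⟩
    · rintro ⟨w, ⟨⟨hw, hs⟩, hp⟩, rfl⟩
      obtain ⟨hd, hh⟩ := (isDyckPath_and_pathHeight_le_iff hw).2 hs
      exact ⟨hd, (numPeaks_steps hw).trans hp, hh⟩
  change Set.ncard {s | IsDyckPath n s ∧ numPeaks n s = j ∧ pathHeight n s ≤ k} = _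
  rw [h, Set.ncard_image_of_injective _ steps_injective, Set.ncard_coe_finset]

theorem mem_dyckWords_add_iff {m j k : ℕ} {w : List Bool} (hw : peaks w = j) :
    w ∈ dyckWords (m + j) (k + 1) ↔ removePeaks w ∈ dyckWords m k := by
  have hl := length_removePeaks w
  rw [mem_dyckWords, mem_dyckWords, staysIn_removePeaks_iff w (by omega), Nat.cast_succ]
  exact and_congr_left fun _ => by omega

theorem dyckCount_add (m j k : ℕ) :
    dyckCount (m + j) j (k + 1) =
      ∑ i ∈ Finset.range (m + 1), dyckCount m i k * (2 * m + j - i).choose (2 * m) := by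
  have hfib : ∀ v ∈ dyckWords m k,
      {w ∈ {w ∈ dyckWords (m + j) (k + 1) | peaks w = j} | removePeaks w = v}.card =
        (2 * m + j - peaks v).choose (2 * m) := by
    intro v hv
    have h : (({w ∈ {w ∈ dyckWords (m + j) (k + 1) | peaks w = j} | removePeaks w = v} :
        Finset (List Bool)) : Set (List Bool)) = insertions v j := by
      ext w
      simp only [Finset.coe_filter, Finset.mem_filter, Set.mem_ofPred_eq, insertions]
      constructor
      · rintro ⟨⟨-, hp⟩, hr⟩
        exact ⟨hr, hp⟩
      · rintro ⟨rfl, hp⟩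
        exact ⟨⟨(mem_dyckWords_add_iff hp).2 hv, hp⟩, rfl⟩
    rw [← Set.ncard_coe_finset, h, Set.ncard, encard_insertions, ENat.toNat_natCast,
      (mem_dyckWords.1 hv).1]
  rw [dyckCount_eq_card, Finset.card_eq_sum_card_fiberwise (f := removePeaks) (t := dyckWords m k),
    Finset.sum_congr rfl hfib,
    ← Finset.sum_fiberwise_of_maps_to (g := peaks) (t := Finset.range (m + 1))]
  · refine Finset.sum_congr rfl fun i _ => ?_
    rw [dyckCount_eq_card]
    exact Finset.sum_const_nat fun v hv => by rw [(Finset.mem_filter.1 hv).2]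
  · intro v hv
    have := two_mul_peaks_le_length v
    have := (mem_dyckWords.1 hv).1
    rw [Finset.mem_range]
    omega
  · intro w hw
    rw [Finset.mem_coe, Finset.mem_filter] at hw
    exact (mem_dyckWords_add_iff hw.2).1 hw.1

end DyckWordCount

theorem dyckCount_recursion (n j k : ℕ) (hk : 1 ≤ k) (hj : 1 ≤ j) (hjn : j ≤ n) :
    dyckCount n j k =
      ∑ i ∈ Finset.range (n - j + 1),
        dyckCount (n - j) i (k - 1) * (2 * n - j - i).choose (2 * n - 2 * j) := by
  obtain ⟨m, rfl⟩ := Nat.exists_eq_add_of_le' hjn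
  obtain ⟨k, rfl⟩ := Nat.exists_eq_add_of_le' hk
  rw [DyckWordCount.dyckCount_add, Nat.add_sub_cancel, Nat.add_sub_cancel]
  refine Finset.sum_congr rfl fun i _ => ?_
  rw [show 2 * (m + j) - j - i = 2 * m + j - i by omega,
    show 2 * (m + j) - 2 * j = 2 * m by omega]
end

section
/- For all k ≥ 1, all n ≥ 1 and all j ≥ 0, the counting numbers a_{n,j}^{(k)} satisfy the recursion a_{n,j}^{(k)} = Σ_{i=0}^{j} a_{j,i}^{(k−1)} · C(n+i, 2j), where by convention a_{0,0}^{(k−1)} = 1. -/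
namespace Avoid231

open Finset

/-- The one-line notation of `σ`, extended by the value `n` outside its domain. -/
def oneLine {n : ℕ} (σ : Equiv.Perm (Fin n)) (i : ℕ) : ℕ :=
  if h : i < n then σ ⟨i, h⟩ else n

lemma oneLine_lt {n : ℕ} (σ : Equiv.Perm (Fin n)) {i : ℕ} (h : i < n) : oneLine σ i < n := by
  simp [oneLine, h]

lemma oneLine_of_le {n : ℕ} (σ : Equiv.Perm (Fin n)) {i : ℕ} (h : n ≤ i) : oneLine σ i = n := by
  simp [oneLine, h]

lemma oneLine_val {n : ℕ} (σ : Equiv.Perm (Fin n)) (i : Fin n) : oneLine σ i = σ i := by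
  simp [oneLine]

lemma oneLine_injOn {n : ℕ} (σ : Equiv.Perm (Fin n)) {i j : ℕ} (hi : i < n) (hj : j < n)
    (h : oneLine σ i = oneLine σ j) : i = j := by
  simpa [oneLine, hi, hj, Fin.val_inj] using h

lemma ext_oneLine {n : ℕ} {σ τ : Equiv.Perm (Fin n)}
    (h : ∀ i < n, oneLine σ i = oneLine τ i) : σ = τ := by
  ext i
  simpa [oneLine_val] using h i i.2

/-- The permutation with a prescribed one-line notation. -/
noncomputable def ofOneLine {n : ℕ} (f : ℕ → ℕ) (hf : ∀ i < n, f i < n)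
    (hinj : ∀ i < n, ∀ j < n, f i = f j → i = j) : Equiv.Perm (Fin n) :=
  Equiv.ofBijective (fun i : Fin n => (⟨f i, hf i i.2⟩ : Fin n))
    (Finite.injective_iff_bijective.1 fun i j h =>
      Fin.ext (hinj i i.2 j j.2 (by simpa using h)))

lemma oneLine_ofOneLine {n : ℕ} (f : ℕ → ℕ) (hf : ∀ i < n, f i < n)
    (hinj : ∀ i < n, ∀ j < n, f i = f j → i = j) {i : ℕ} (hi : i < n) :
    oneLine (ofOneLine f hf hinj) i = f i := by
  simp [oneLine, hi, ofOneLine]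

lemma avoids231_iff {n : ℕ} (σ : Equiv.Perm (Fin n)) :
    avoids231 σ ↔ ∀ i j k : ℕ, i < j → j < k → k < n →
      oneLine σ k < oneLine σ i → ¬ oneLine σ i < oneLine σ j := by
  constructor
  · intro h i j k hij hjk hk h1 h2
    refine h ⟨⟨i, by omega⟩, ⟨j, by omega⟩, ⟨k, hk⟩, hij, hjk, ?_, ?_⟩
    · simpa [Fin.lt_def, ← oneLine_val] using h1
    · simpa [Fin.lt_def, ← oneLine_val] using h2
  · rintro h ⟨i, j, k, hij, hjk, h1, h2⟩
    refine h i j k hij hjk k.2 ?_ ?_ <;> simpa [oneLine_val]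

lemma maxDrop_le_iff {n : ℕ} (σ : Equiv.Perm (Fin n)) (k : ℕ) :
    maxDrop σ ≤ k ↔ ∀ i < n, i < oneLine σ i + (k + 1) := by
  rw [maxDrop, Finset.sup_le_iff]
  constructor
  · intro h i hi
    have : i - (σ ⟨i, hi⟩ : ℕ) ≤ k := h ⟨i, hi⟩ (mem_univ _)
    simp only [oneLine, hi, dif_pos]
    omega
  · intro h i _
    have := h i i.2
    rw [oneLine_val] at this
    omega

lemma des_eq {n : ℕ} (σ : Equiv.Perm (Fin n)) :
    des σ = ∑ i ∈ range n, if oneLine σ (i + 1) < oneLine σ i then 1 else 0 := by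
  classical
  rw [des, Nat.card_eq_fintype_card, Fintype.card_subtype, Finset.card_filter,
    Finset.sum_range]
  refine sum_congr rfl fun i _ => ?_
  congr 1
  rw [oneLine_val]
  by_cases h : (i : ℕ) + 1 < n
  · simp [h, oneLine]
  · simp [h, oneLine, (σ i).2.le]

lemma des_le {n : ℕ} (σ : Equiv.Perm (Fin n)) : des σ ≤ n := by
  rw [des_eq]
  refine (sum_le_card_nsmul _ _ 1 fun i _ => ?_).trans (by simp)
  split_ifs <;> simp

/-- The one-line notation of the concatenation `L n R`, with the values of `R` shifted by `p`. -/
def glueFun {p q : ℕ} (n : ℕ) (L : Equiv.Perm (Fin p)) (R : Equiv.Perm (Fin q)) (i : ℕ) : ℕ :=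
  if i < p then oneLine L i else if i = p then n else p + oneLine R (i - p - 1)

lemma glueFun_lt {n p q : ℕ} (h : p + q = n) (L : Equiv.Perm (Fin p)) (R : Equiv.Perm (Fin q)) :
    ∀ i < n + 1, glueFun n L R i < n + 1 := by
  intro i hi
  unfold glueFun
  split_ifs with h1 h2
  · have := oneLine_lt L h1
    omega
  · omega
  · have := oneLine_lt R (i := i - p - 1) (by omega)
    omega

lemma glueFun_injOn {n p q : ℕ} (h : p + q = n) (L : Equiv.Perm (Fin p))
    (R : Equiv.Perm (Fin q)) :
    ∀ i < n + 1, ∀ j < n + 1, glueFun n L R i = glueFun n L R j → i = j := by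
  intro i hi j hj
  have hL : ∀ i < p, oneLine L i < p := fun i => oneLine_lt L
  have hR : ∀ i < q, oneLine R i < q := fun i => oneLine_lt R
  have hL' : ∀ i < p, ∀ j < p, oneLine L i = oneLine L j → i = j :=
    fun i hi j hj => oneLine_injOn L hi hj
  have hR' : ∀ i < q, ∀ j < q, oneLine R i = oneLine R j → i = j :=
    fun i hi j hj => oneLine_injOn R hi hj
  unfold glueFun
  have := hL i
  have := hL j
  have := hR (i - p - 1)
  have := hR (j - p - 1)
  split_ifs with h1 h2 <;> intro he
  · exact hL' i h1 j h2 he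
  any_goals omega
  have := hR' (i - p - 1) (by omega) (j - p - 1) (by omega) (by omega)
  omega

/-- The permutation `L n R`, with the values of `R` shifted by `p`. -/
noncomputable def glue {n p q : ℕ} (h : p + q = n) (L : Equiv.Perm (Fin p))
    (R : Equiv.Perm (Fin q)) : Equiv.Perm (Fin (n + 1)) :=
  ofOneLine (glueFun n L R) (glueFun_lt h L R) (glueFun_injOn h L R)

section Glue

variable {n p q : ℕ} (h : p + q = n) (L : Equiv.Perm (Fin p)) (R : Equiv.Perm (Fin q))

lemma oneLine_glue_left {i : ℕ} (hi : i < p) : oneLine (glue h L R) i = oneLine L i := by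
  rw [glue, oneLine_ofOneLine _ _ _ (by omega), glueFun, if_pos hi]

lemma oneLine_glue_mid : oneLine (glue h L R) p = n := by
  rw [glue, oneLine_ofOneLine _ _ _ (by omega), glueFun, if_neg (by omega), if_pos rfl]

lemma oneLine_glue_right {i : ℕ} (hi : i < q) :
    oneLine (glue h L R) (p + 1 + i) = p + oneLine R i := by
  rw [glue, oneLine_ofOneLine _ _ _ (by omega), glueFun, if_neg (by omega), if_neg (by omega)]
  congr 2
  omega

lemma des_glue : des (glue h L R) = des L + if q = 0 then 0 else des R + 1 := by
  have hn : n + 1 = p + 1 + q := by omega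
  have key : des (glue h L R) = des L + (if q = 0 then 0 else 1) + des R := by
    rw [des_eq, congrArg range hn, sum_range_add, sum_range_succ, des_eq, des_eq]
    congr 1
    · congr 1
      · refine sum_congr rfl fun i hi => ?_
        have hi := mem_range.1 hi
        have := oneLine_lt L hi
        rw [oneLine_glue_left h L R hi]
        rcases Nat.lt_or_ge (i + 1) p with h1 | h1
        · rw [oneLine_glue_left h L R h1]
        · obtain rfl : i + 1 = p := by omega
          rw [oneLine_glue_mid h L R, oneLine_of_le L le_rfl]
          congr 1
          simp only [eq_iff_iff]
          omega
      · rw [oneLine_glue_mid h L R]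
        rcases Nat.eq_zero_or_pos q with h0 | h0
        · rw [oneLine_of_le _ (by omega)]
          simp [h0]
        · have := oneLine_glue_right h L R h0
          have := oneLine_lt R h0
          rw [if_pos (by simp_all; omega), if_neg (by omega)]
    · refine sum_congr rfl fun i hi => ?_
      have hi := mem_range.1 hi
      have := oneLine_lt R hi
      rw [oneLine_glue_right h L R hi]
      rcases Nat.lt_or_ge (i + 1) q with h1 | h1
      · rw [add_assoc (p + 1), oneLine_glue_right h L R h1]
        simp
      · rw [oneLine_of_le R h1, oneLine_of_le _ (by omega)]
        congr 1
        simp only [eq_iff_iff]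
        omega
  rw [key]
  split_ifs with h0
  · subst h0
    simp [des_eq R]
  · ring

lemma avoids231_glue : avoids231 (glue h L R) ↔ avoids231 L ∧ avoids231 R := by
  simp only [avoids231_iff]
  constructor
  · intro H
    constructor
    · intro i j k hij hjk hk
      have := H i j k hij hjk (by omega)
      rwa [oneLine_glue_left h L R hk, oneLine_glue_left h L R (by omega),
        oneLine_glue_left h L R (by omega)] at this
    · intro i j k hij hjk hk
      have := H (p + 1 + i) (p + 1 + j) (p + 1 + k) (by omega) (by omega) (by omega)
      rwa [oneLine_glue_right h L R hk, oneLine_glue_right h L R (by omega),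
        oneLine_glue_right h L R (by omega), add_lt_add_iff_left, add_lt_add_iff_left] at this
  · rintro ⟨HL, HR⟩ i j k hij hjk hk
    have hl : ∀ i < p, oneLine (glue h L R) i < p := fun i hi => by
      rw [oneLine_glue_left h L R hi]
      exact oneLine_lt L hi
    have hr : ∀ i < n + 1, p < i → p ≤ oneLine (glue h L R) i := fun i hi hi' => by
      obtain ⟨r, rfl⟩ := Nat.exists_eq_add_of_lt hi'
      have := oneLine_glue_right h L R (i := r) (by omega)
      rw [show p + r + 1 = p + 1 + r by ring]
      omega
    have hle : ∀ i < n + 1, oneLine (glue h L R) i < n + 1 := fun i hi => oneLine_lt _ hi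
    have hm := oneLine_glue_mid h L R
    rcases Nat.lt_trichotomy i p with hi | rfl | hi
    · rcases Nat.lt_trichotomy k p with hk' | rfl | hk'
      · rw [oneLine_glue_left h L R hk', oneLine_glue_left h L R (by omega),
          oneLine_glue_left h L R (by omega)]
        exact HL i j k hij hjk hk'
      · have := hl i hi
        omega
      · have := hl i hi
        have := hr k hk hk'
        omega
    · have := hle j (by omega)
      omega
    · obtain ⟨r, rfl⟩ := Nat.exists_eq_add_of_le (Nat.succ_le_of_lt hi)
      obtain ⟨s, rfl⟩ := Nat.exists_eq_add_of_le (show p + 1 ≤ j by omega)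
      obtain ⟨t, rfl⟩ := Nat.exists_eq_add_of_le (show p + 1 ≤ k by omega)
      rw [Nat.succ_eq_add_one, oneLine_glue_right h L R (by omega),
        oneLine_glue_right h L R (by omega), oneLine_glue_right h L R (by omega),
        add_lt_add_iff_left, add_lt_add_iff_left]
      exact HR r s t (by omega) (by omega) (by omega)

lemma drop_glue (m : ℕ) : (∀ i < n + 1, i < oneLine (glue h L R) i + (m + 1)) ↔
    (∀ i < p, i < oneLine L i + (m + 1)) ∧ ∀ i < q, i < oneLine R i + m := by
  constructor
  · intro H
    constructor
    · intro i hi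
      have := H i (by omega)
      rwa [oneLine_glue_left h L R hi] at this
    · intro i hi
      have := H (p + 1 + i) (by omega)
      rw [oneLine_glue_right h L R hi] at this
      omega
  · rintro ⟨HL, HR⟩ i hi
    rcases Nat.lt_trichotomy i p with hi' | rfl | hi'
    · rw [oneLine_glue_left h L R hi']
      exact HL i hi'
    · rw [oneLine_glue_mid h L R]
      omega
    · obtain ⟨r, rfl⟩ := Nat.exists_eq_add_of_le (Nat.succ_le_of_lt hi')
      have := HR r (by omega)
      rw [Nat.succ_eq_add_one, oneLine_glue_right h L R (by omega)]
      omega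

end Glue

lemma glue_injective {n p q : ℕ} (h : p + q = n) {L L' : Equiv.Perm (Fin p)}
    {R R' : Equiv.Perm (Fin q)} (he : glue h L R = glue h L' R') : L = L' ∧ R = R' := by
  constructor <;> refine ext_oneLine fun i hi => ?_
  · rw [← oneLine_glue_left h L R hi, he, oneLine_glue_left h L' R' hi]
  · have := oneLine_glue_right h L R hi
    rw [he, oneLine_glue_right h L' R' hi] at this
    omega

/-- In a 231-avoiding permutation the values before the maximum are smaller than those after. -/
lemma exists_glue_eq {n : ℕ} (σ : Equiv.Perm (Fin (n + 1))) (hσ : avoids231 σ) :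
    ∃ p q : ℕ, ∃ h : p + q = n, ∃ (L : Equiv.Perm (Fin p)) (R : Equiv.Perm (Fin q)),
      glue h L R = σ := by
  rw [avoids231_iff] at hσ
  obtain ⟨p, hp, hmax⟩ : ∃ p < n + 1, oneLine σ p = n :=
    ⟨σ.symm (Fin.last n), Fin.is_lt _, by rw [oneLine_val]; simp⟩
  have hlt : ∀ i < n + 1, i ≠ p → oneLine σ i < n := fun i hi hip => by
    have := oneLine_lt σ hi
    have : oneLine σ i ≠ n := fun he => hip (oneLine_injOn σ hi hp (he.trans hmax.symm))
    omega
  have hsep : ∀ i < p, ∀ j < n + 1, p < j → oneLine σ i < oneLine σ j := fun i hi j hj hpj => by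
    by_contra hc
    have hne : oneLine σ i ≠ oneLine σ j := fun he => by
      have := oneLine_injOn σ (by omega) hj he
      omega
    refine hσ i p j hi hpj hj (by omega) ?_
    rw [hmax]
    exact hlt i (by omega) (by omega)
  have hleft : ∀ i < p, oneLine σ i < p := fun i hi => by
    have : #(Ioo p (n + 1)) ≤ #(Ioo (oneLine σ i) n) :=
      card_le_card_of_injOn (oneLine σ)
        (fun j hj => by
          have hj := mem_Ioo.1 (mem_coe.1 hj)
          exact mem_coe.2 (mem_Ioo.2 ⟨hsep i hi j hj.2 hj.1, hlt j hj.2 (by omega)⟩))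
        (fun j hj j' hj' => oneLine_injOn σ (mem_Ioo.1 (mem_coe.1 hj)).2
          (mem_Ioo.1 (mem_coe.1 hj')).2)
    have := hlt i (by omega) (by omega)
    simp only [Nat.card_Ioo] at *
    omega
  have hright : ∀ i < n + 1, p < i → p ≤ oneLine σ i := fun i hi hpi => by
    have : #(range p) ≤ #(range (oneLine σ i)) :=
      card_le_card_of_injOn (oneLine σ)
        (fun j hj => by
          have hj := mem_range.1 (mem_coe.1 hj)
          exact mem_coe.2 (mem_range.2 (hsep j hj i hi hpi)))
        (fun j hj j' hj' => by
          have hj := mem_range.1 (mem_coe.1 hj)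
          have hj' := mem_range.1 (mem_coe.1 hj')
          exact oneLine_injOn σ (by omega) (by omega))
    simpa using this
  refine ⟨p, n - p, by omega,
    ofOneLine (oneLine σ) hleft fun i hi j hj => oneLine_injOn σ (by omega) (by omega),
    ofOneLine (fun i => oneLine σ (p + 1 + i) - p)
      (fun i hi => ?_) (fun i hi j hj he => ?_), ?_⟩
  · have := hlt (p + 1 + i) (by omega) (by omega)
    omega
  · have h1 := hright (p + 1 + i) (by omega) (by omega)
    have h2 := hright (p + 1 + j) (by omega) (by omega)
    have := oneLine_injOn σ (i := p + 1 + i) (j := p + 1 + j) (by omega) (by omega)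
      (by omega)
    omega
  · refine ext_oneLine fun i hi => ?_
    rcases Nat.lt_trichotomy i p with hi' | rfl | hi'
    · rw [oneLine_glue_left _ _ _ hi', oneLine_ofOneLine _ _ _ hi']
    · rw [oneLine_glue_mid, hmax]
    · obtain ⟨r, rfl⟩ := Nat.exists_eq_add_of_le (Nat.succ_le_of_lt hi')
      have := hright (p + 1 + r) (by omega) (by omega)
      rw [Nat.succ_eq_add_one, oneLine_glue_right _ _ _ (by omega),
        oneLine_ofOneLine _ _ _ (by omega)]
      omega

open Classical in
/-- The 231-avoiding permutations all of whose drops are less than `m`. -/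
noncomputable def bounded (m n : ℕ) : Finset (Equiv.Perm (Fin n)) :=
  univ.filter fun σ => avoids231 σ ∧ ∀ i < n, i < oneLine σ i + m

lemma mem_bounded {m n : ℕ} {σ : Equiv.Perm (Fin n)} :
    σ ∈ bounded m n ↔ avoids231 σ ∧ ∀ i < n, i < oneLine σ i + m := by
  simp [bounded]

lemma bounded_zero_right (m : ℕ) : bounded m 0 = univ := by
  simp [bounded, avoids231]

lemma glue_mem_bounded {m n p q : ℕ} (h : p + q = n) (L : Equiv.Perm (Fin p))
    (R : Equiv.Perm (Fin q)) :
    glue h L R ∈ bounded (m + 1) (n + 1) ↔ L ∈ bounded (m + 1) p ∧ R ∈ bounded m q := by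
  simp only [mem_bounded, avoids231_glue, drop_glue]
  tauto

lemma a_eq_card (n j k : ℕ) : a n j k = #{σ ∈ bounded (k + 1) n | des σ = j} := by
  classical
  rw [a, Nat.card_eq_fintype_card, Fintype.card_subtype, bounded, filter_filter]
  congr 1
  ext σ
  simp only [mem_filter, mem_univ, true_and, maxDrop_le_iff]
  tauto

lemma bounded_zero_succ (n : ℕ) : bounded 0 (n + 1) = ∅ := by
  refine eq_empty_of_forall_notMem fun σ H => ?_
  have := (mem_bounded.1 H).2 n (by omega)
  have := oneLine_lt σ (Nat.lt_succ_self n)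
  omega

section Weight

variable {S : Type*} [CommRing S]

/-- The homogeneous descent enumerator of `bounded m n`. -/
noncomputable def weight (x y : S) (m n : ℕ) : S :=
  ∑ σ ∈ bounded m n, x ^ des σ * y ^ (n - des σ)

lemma weight_zero (x y : S) (m : ℕ) : weight x y m 0 = 1 := by
  simp [weight, bounded_zero_right, des_eq]

lemma weight_zero_succ (x y : S) (n : ℕ) : weight x y 0 (n + 1) = 0 := by
  simp [weight, bounded_zero_succ]

lemma weight_glue (x y : S) {n p q : ℕ} (h : p + q = n) (L : Equiv.Perm (Fin p))
    (R : Equiv.Perm (Fin q)) :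
    x ^ des (glue h L R) * y ^ (n + 1 - des (glue h L R)) =
      x ^ des L * y ^ (p - des L) *
        if q = 0 then y else x * (x ^ des R * y ^ (q - des R)) := by
  have h1 := des_le L
  have h2 := des_le R
  rw [des_glue]
  split_ifs with hq
  · rw [add_zero, mul_assoc, ← pow_succ]
    congr 2
    omega
  · rw [show n + 1 - (des L + (des R + 1)) = (p - des L) + (q - des R) by omega]
    ring

lemma weight_succ_eq_sum (x y : S) (m n : ℕ) :
    weight x y (m + 1) (n + 1) = ∑ c ∈ antidiagonal n,
      weight x y (m + 1) c.1 * if c.2 = 0 then y else x * weight x y m c.2 := by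
  have hterm : ∀ c : ℕ × ℕ, (weight x y (m + 1) c.1 *
      if c.2 = 0 then y else x * weight x y m c.2) =
      ∑ LR ∈ bounded (m + 1) c.1 ×ˢ bounded m c.2,
        x ^ des LR.1 * y ^ (c.1 - des LR.1) *
          if c.2 = 0 then y else x * (x ^ des LR.2 * y ^ (c.2 - des LR.2)) := by
    rintro ⟨p, q⟩
    rw [sum_product, weight, sum_mul]
    refine sum_congr rfl fun L _ => ?_
    dsimp only
    rw [← mul_sum]
    congr 1
    by_cases hq : q = 0
    · subst hq
      simp [bounded_zero_right]
    · simp only [hq, if_false]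
      rw [weight, mul_sum]
  simp_rw [hterm]
  rw [sum_sigma', weight]
  symm
  refine sum_bij
    (fun c hc => glue (HasAntidiagonal.mem_antidiagonal.1 (mem_sigma.1 hc).1) c.2.1 c.2.2) ?_ ?_ ?_ ?_
  · rintro ⟨⟨p, q⟩, L, R⟩ hc
    exact (glue_mem_bounded _ L R).2 (mem_product.1 (mem_sigma.1 hc).2)
  · rintro ⟨⟨p, q⟩, L, R⟩ hc ⟨⟨p', q'⟩, L', R'⟩ hc' he
    have h1 : p + q = n := HasAntidiagonal.mem_antidiagonal.1 (mem_sigma.1 hc).1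
    have h2 : p' + q' = n := HasAntidiagonal.mem_antidiagonal.1 (mem_sigma.1 hc').1
    dsimp only at he
    obtain rfl : p = p' := by
      refine oneLine_injOn (glue h1 L R) (by omega) (by omega) ?_
      rw [oneLine_glue_mid, he, oneLine_glue_mid]
    obtain rfl : q = q' := by omega
    obtain ⟨rfl, rfl⟩ := glue_injective h1 he
    rfl
  · intro σ hσ
    obtain ⟨p, q, h, L, R, rfl⟩ := exists_glue_eq σ (mem_bounded.1 hσ).1
    exact ⟨⟨(p, q), L, R⟩, mem_sigma.2 ⟨HasAntidiagonal.mem_antidiagonal.2 h,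
      mem_product.2 ((glue_mem_bounded h L R).1 hσ)⟩, rfl⟩
  · rintro ⟨⟨p, q⟩, L, R⟩ hc
    exact (weight_glue x y _ L R).symm

lemma weight_succ (x y : S) (m n : ℕ) :
    weight x y (m + 1) (n + 1) = (y - x) * weight x y (m + 1) n +
      x * ∑ c ∈ antidiagonal n, weight x y (m + 1) c.1 * weight x y m c.2 := by
  have hsplit : ∀ c : ℕ × ℕ, (weight x y (m + 1) c.1 *
      if c.2 = 0 then y else x * weight x y m c.2) =
      (if c.2 = 0 then (y - x) * weight x y (m + 1) c.1 else 0) +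
        x * (weight x y (m + 1) c.1 * weight x y m c.2) := by
    rintro ⟨p, q⟩
    by_cases hq : q = 0
    · subst hq
      simp [weight_zero]
      ring
    · simp [hq]
      ring
  rw [weight_succ_eq_sum, sum_congr rfl fun c _ => hsplit c, sum_add_distrib, ← mul_sum]
  congr 1
  rw [sum_eq_single (n, 0)]
  · simp
  · rintro ⟨p, q⟩ hc hne
    rw [HasAntidiagonal.mem_antidiagonal] at hc
    refine if_neg fun h0 => hne ?_
    simp_all
  · simp

end Weight

/-- The generating function over `n` of the number of `σ ∈ bounded m n` with `j` descents. -/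
noncomputable def desSeries (m j : ℕ) : PowerSeries ℤ :=
  PowerSeries.mk fun n => (weight (Polynomial.X : Polynomial ℤ) 1 m n).coeff j

lemma coeff_weight (m n j : ℕ) :
    (weight (Polynomial.X : Polynomial ℤ) 1 m n).coeff j = #{σ ∈ bounded m n | des σ = j} := by
  simp only [weight, one_pow, mul_one, Polynomial.finsetSum_coeff, Polynomial.coeff_X_pow,
    card_filter, eq_comm (a := j)]
  push_cast
  rfl

lemma desSeries_zero_mul (m : ℕ) : desSeries (m + 1) 0 * (1 - PowerSeries.X) = 1 := by
  have h : desSeries (m + 1) 0 = PowerSeries.mk 1 := by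
    ext n
    simp only [desSeries, PowerSeries.coeff_mk, Pi.one_apply]
    induction n with
    | zero => simp [weight_zero]
    | succ n ih =>
      rw [weight_succ]
      simpa [sub_mul] using ih
  rw [h, PowerSeries.mk_one_mul_one_sub_eq_one]

lemma desSeries_succ_mul (m j : ℕ) :
    desSeries (m + 1) (j + 1) * (1 - PowerSeries.X) =
      PowerSeries.X * ∑ c ∈ antidiagonal j, desSeries (m + 1) c.1 * desSeries m c.2 -
        PowerSeries.X * desSeries (m + 1) j := by
  ext n
  cases n with
  | zero => simp [desSeries, weight_zero, Polynomial.coeff_one]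
  | succ n =>
    rw [mul_sub, mul_one, map_sub, map_sub, PowerSeries.coeff_succ_mul_X,
      PowerSeries.coeff_succ_X_mul, PowerSeries.coeff_succ_X_mul, map_sum]
    simp only [desSeries, PowerSeries.coeff_mk, PowerSeries.coeff_mul]
    rw [weight_succ, Polynomial.coeff_add, sub_mul, one_mul, Polynomial.coeff_sub,
      Polynomial.coeff_X_mul, Polynomial.coeff_X_mul, Polynomial.finsetSum_coeff, sum_comm]
    simp only [Polynomial.coeff_mul]
    ring

lemma desSeries_mul_pow (m j : ℕ) :
    desSeries (m + 1) j * (1 - PowerSeries.X) ^ (2 * j + 1) =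
      weight (PowerSeries.X : PowerSeries ℤ) (PowerSeries.X ^ 2) m j := by
  induction m generalizing j with
  | zero =>
    cases j with
    | zero => simpa [weight_zero] using desSeries_zero_mul 0
    | succ j =>
      have h0 : ∀ c : ℕ × ℕ, desSeries 0 c.2 = if c.2 = 0 then 1 else 0 := by
        rintro ⟨-, q⟩
        ext n
        cases n with
        | zero => by_cases hq : q = 0 <;> simp [desSeries, weight_zero, Polynomial.coeff_one, hq]
        | succ n => by_cases hq : q = 0 <;>
            simp [desSeries, weight_zero_succ, PowerSeries.coeff_one, hq]
      have hs : ∑ c ∈ antidiagonal j, desSeries (0 + 1) c.1 * desSeries 0 c.2 =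
          desSeries (0 + 1) j := by
        rw [sum_eq_single (j, 0)]
        · rw [h0, if_pos rfl, mul_one]
        · rintro ⟨p, q⟩ hc hne
          rw [HasAntidiagonal.mem_antidiagonal] at hc
          rw [h0, if_neg fun hq => hne (by simp_all), mul_zero]
        · simp
      rw [weight_zero_succ, pow_succ', ← mul_assoc, desSeries_succ_mul, hs, sub_self, zero_mul]
  | succ m ihm =>
    induction j using Nat.strong_induction_on with
    | _ j ihj =>
    cases j with
    | zero => simpa [weight_zero] using desSeries_zero_mul (m + 1)
    | succ j =>
      rw [weight_succ, ← ihj j (Nat.lt_succ_self j), pow_succ', ← mul_assoc, desSeries_succ_mul]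
      have hs : ∑ c ∈ antidiagonal j,
          weight (PowerSeries.X : PowerSeries ℤ) (PowerSeries.X ^ 2) (m + 1) c.1 *
            weight (PowerSeries.X : PowerSeries ℤ) (PowerSeries.X ^ 2) m c.2 =
          (∑ c ∈ antidiagonal j, desSeries (m + 1 + 1) c.1 * desSeries (m + 1) c.2) *
            (1 - PowerSeries.X) ^ (2 * (j + 1)) := by
        rw [sum_mul]
        refine sum_congr rfl fun c hc => ?_
        rw [HasAntidiagonal.mem_antidiagonal] at hc
        rw [← ihj c.1 (by omega), ← ihm c.2,
          show 2 * (j + 1) = (2 * c.1 + 1) + (2 * c.2 + 1) by omega, pow_add]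
        ring
      rw [hs]
      ring

lemma coeff_X_pow_mul_invOneSubPow {j d : ℕ} (hd : d ≤ j) (n : ℕ) :
    PowerSeries.coeff n ((PowerSeries.X : PowerSeries ℤ) ^ d * (PowerSeries.X ^ 2) ^ (j - d) *
      (PowerSeries.invOneSubPow ℤ (2 * j + 1)).val) = ((n + d).choose (2 * j) : ℤ) := by
  rw [← pow_mul, ← pow_add, PowerSeries.coeff_X_pow_mul',
    PowerSeries.invOneSubPow_val_succ_eq_mk_add_choose,
    PowerSeries.coeff_mk]
  split_ifs with h
  · congr 2
    omega
  · rw [Nat.choose_eq_zero_of_lt (by omega), Nat.cast_zero]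

theorem recursion (n j k : ℕ) (hk : 1 ≤ k) :
    a n j k = ∑ i ∈ Finset.range (j + 1), a j i (k - 1) * (n + i).choose (2 * j) := by
  obtain ⟨k, rfl⟩ : ∃ m, k = m + 1 := ⟨k - 1, by omega⟩
  have hA : desSeries (k + 1 + 1) j =
      weight (PowerSeries.X : PowerSeries ℤ) (PowerSeries.X ^ 2) (k + 1) j *
        (PowerSeries.invOneSubPow ℤ (2 * j + 1)).val := by
    rw [← desSeries_mul_pow, mul_assoc, ← PowerSeries.invOneSubPow_inv_eq_one_sub_pow,
      Units.inv_val, mul_one]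
  have hcoeff := congrArg (PowerSeries.coeff n) hA
  rw [desSeries, PowerSeries.coeff_mk, coeff_weight, ← a_eq_card, weight, Finset.sum_mul, map_sum,
    Finset.sum_congr rfl fun σ _ => coeff_X_pow_mul_invOneSubPow (des_le σ) n] at hcoeff
  rw [Nat.add_sub_cancel]
  have hcast : a n j (k + 1) = ∑ σ ∈ bounded (k + 1) j, (n + des σ).choose (2 * j) := by
    exact_mod_cast hcoeff
  rw [hcast, ← Finset.sum_fiberwise_of_maps_to (g := des) (t := Finset.range (j + 1))
    fun σ _ => Finset.mem_range.2 (Nat.lt_succ_of_le (des_le σ))]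
  refine Finset.sum_congr rfl fun i _ => ?_
  rw [a_eq_card, Finset.sum_const_nat fun σ hσ => ?_]
  rw [(Finset.mem_filter.1 hσ).2]

end Avoid231

theorem a_recursion (n j k : ℕ) (hk : 1 ≤ k) (hn : 1 ≤ n) :
    a n j k = ∑ i ∈ Finset.range (j + 1), a j i (k - 1) * (n + i).choose (2 * j) := by
  exact Avoid231.recursion n j k hk
end
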